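/- arXiv:1010.5699 — 2 statements merged into one kernel-verified Lean document; each statement's English description precedes it below -/
import Mathlib

section
/- Let d≥3 be an integer, W=ℝ^{d+1}, D=binom(d+1,2). Let G=(V,E) be a finite multigraph and {B,R} a partition of V. Then there exists a rod-configuration r on R (each r_v∈⋀^{d−1}W nonzero decomposable, pairwise non-proportional) such that for every nonempty F⊆E, the dimension of the subspace Σ_{e∈F} A_e(r) of the space of functions V→⋀²W equals the minimum of Σ_{i=1}^k (D·|V(F_i)| − D − |R(F_i)|) over all partitions {F_1,…,F_k} of F into nonempty parts, where R(F_i)=V(F_i)∩R. (Existential form of: for almost all rod-configurations, the linear polymatroid of the flats A_e(r) equals the polymatroid induced by f(F)=D(|V(F)|−1)−|R(F)|.) -/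
/- STATEMENT 1: for a suitable (generic) rod-configuration, the linear polymatroid of the
flats `A_e(r)` equals the count polymatroid induced by `f(F) = D(|V(F)|-1) - |R(F)|`. -/

set_option synthInstance.maxHeartbeats 1000000
set_option maxHeartbeats 1000000

open ExteriorAlgebra

/-- `W = ℝ^{d+1}`. -/
abbrev Wd (d : ℕ) : Type := Fin (d + 1) → ℝ

/-- The exterior algebra of `W = ℝ^{d+1}`; the exterior powers `⋀^k W` are realized as
the degree-`k` homogeneous submodules of this algebra, and the exterior product is the
algebra multiplication. -/
abbrev ExtAlg (d : ℕ) : Type := ExteriorAlgebra ℝ (Wd d)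

/-- The degree-`k` homogeneous part `⋀^k W` of the exterior algebra. -/
noncomputable def extGrade (d k : ℕ) : Submodule ℝ (ExtAlg d) :=
  (LinearMap.range (ι ℝ : Wd d →ₗ[ℝ] ExtAlg d)) ^ k

/-- `x` is a decomposable element of `⋀^k W`, i.e. `x = w₁ ∧ ⋯ ∧ w_k`. -/
def IsDecomp (d k : ℕ) (x : ExtAlg d) : Prop :=
  ∃ w : Fin k → Wd d, x = (List.ofFn fun i => ι ℝ (w i)).prod

/-- The set `V(F)` of vertices spanned by an edge set `F`. -/
def VF {V E : Type} [DecidableEq V] (ends : E → V × V) (F : Finset E) : Finset V :=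
  F.image (fun e => (ends e).1) ∪ F.image (fun e => (ends e).2)

/-- `P` is a partition of `F` into nonempty parts. -/
def IsPartitionOf {E : Type} [DecidableEq E] (F : Finset E) (P : Finset (Finset E)) : Prop :=
  (∀ p ∈ P, p.Nonempty) ∧ (P : Set (Finset E)).PairwiseDisjoint id ∧ P.biUnion id = F

/-- The subspace of admissible bar coordinates for a bar joining `u` and `v`:
elements of `⋀² W` which annihilate (by wedge) the rods at those endpoints lying in `R`. -/
noncomputable def barSpace {V : Type} [DecidableEq V] (d : ℕ) (r : V → ExtAlg d)
    (R : Finset V) (u v : V) : Submodule ℝ (ExtAlg d) :=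
  extGrade d 2 ⊓ (⨅ w ∈ ({u, v} : Finset V) ∩ R, LinearMap.ker (LinearMap.mulRight ℝ (r w)))

/-- The flat `A_e(r) = {δ_u·α − δ_v·α : α ∈ ⋀²W, α ∧ r_w = 0 for each endpoint w ∈ R}`
inside the space of functions `V → ⋀²W`. -/
noncomputable def rodFlat {V E : Type} [DecidableEq V] (d : ℕ) (ends : E → V × V)
    (r : V → ExtAlg d) (R : Finset V) (e : E) : Submodule ℝ (V → ExtAlg d) :=
  (barSpace d r R (ends e).1 (ends e).2).map
    (LinearMap.single ℝ (fun _ : V => ExtAlg d) (ends e).1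
      - LinearMap.single ℝ (fun _ : V => ExtAlg d) (ends e).2)


section
set_option linter.unusedSectionVars false
set_option linter.unusedSimpArgs false
open Finset Module
variable {V : Type} [Fintype V] [DecidableEq V] {U : Type} [AddCommGroup U] [Module ℝ U] [FiniteDimensional ℝ U]

def XX (h : V → U →ₗ[ℝ] ℝ) (S A : Finset V) : Submodule ℝ (V → U) where
  carrier := {x | (∀ v, v ∉ A → x v = 0) ∧ ∑ v, x v = 0 ∧ ∀ v ∈ S, h v (x v) = 0}
  add_mem' := by
    rintro a b ⟨a1, a2, a3⟩ ⟨b1, b2, b3⟩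
    refine ⟨fun v hv => by simp [a1 v hv, b1 v hv], by simp [Finset.sum_add_distrib, a2, b2], fun v hv => by simp [a3 v hv, b3 v hv]⟩
  zero_mem' := by simp
  smul_mem' := by
    rintro c a ⟨a1, a2, a3⟩
    refine ⟨fun v hv => by simp [a1 v hv], by simp [← Finset.smul_sum, a2], fun v hv => by simp [a3 v hv]⟩

def TT (h : V → U →ₗ[ℝ] ℝ) (S : Finset V) (H : Finset (Finset V)) : Submodule ℝ (V → U) :=
  ⨆ A ∈ H, XX h S A

def fp (D : ℕ) (S A : Finset V) : ℤ :=
  if A.card ≤ 1 then 0 else (D : ℤ) * A.card - D - ((A ∩ S).card : ℤ)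

def cc (D : ℕ) (S : Finset V) (P : Finset (Finset V)) : ℤ := ∑ B ∈ P, fp D S B

def Cov (H P : Finset (Finset V)) : Prop := ∀ A ∈ H, ∃ B ∈ P, A ⊆ B

structure Gen (h : V → U →ₗ[ℝ] ℝ) : Prop where
  indep : ∀ u w, u ≠ w → ∃ y, h u y = 0 ∧ h w y ≠ 0
  gen : ∀ (S : Finset V) (w : V), w ∉ S → ∀ (A1 A2 : Finset V) (H0 : Finset (Finset V)),
    (∃ x1 ∈ XX h S A1, ∃ x2 ∈ XX h S A2, x1 + x2 ∈ TT h S H0 ∧ x1 w ≠ 0) →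
    (∃ x1 ∈ XX h S A1, ∃ x2 ∈ XX h S A2, x1 + x2 ∈ TT h S H0 ∧ h w (x1 w) ≠ 0)

lemma mem_XX {h : V → U →ₗ[ℝ] ℝ} {S A : Finset V} {x : V → U} :
    x ∈ XX h S A ↔ (∀ v, v ∉ A → x v = 0) ∧ ∑ v, x v = 0 ∧ ∀ v ∈ S, h v (x v) = 0 := Iff.rfl

lemma XX_mono (h : V → U →ₗ[ℝ] ℝ) (S : Finset V) {A B : Finset V} (hAB : A ⊆ B) :
    XX h S A ≤ XX h S B := by
  rintro x ⟨a, b, c⟩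
  exact ⟨fun v hv => a v (fun h' => hv (hAB h')), b, c⟩

lemma XX_bot (h : V → U →ₗ[ℝ] ℝ) (S : Finset V) {A : Finset V} (hA : A.card ≤ 1) :
    XX h S A = ⊥ := by
  rw [eq_bot_iff]
  rintro x ⟨a, b, c⟩
  rw [Submodule.mem_bot]
  funext v
  by_cases hv : v ∈ A
  · have : ∑ v, x v = x v := by
      apply Finset.sum_eq_single
      · intro u _ hu
        exact a u (fun hu' => hu (Finset.card_le_one.1 hA u hu' v hv))
      · simp
    rw [← this, b]; rfl
  · exact a v hv

/-- two different kernels span -/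
lemma ker_split {h : V → U →ₗ[ℝ] ℝ} (hg : Gen h) {a b : V} (hab : a ≠ b) (z : U) :
    ∃ p q : U, p + q = z ∧ h a p = 0 ∧ h b q = 0 := by
  obtain ⟨y, hy, hy'⟩ := hg.indep a b hab
  refine ⟨(h b z / h b y) • y, z - (h b z / h b y) • y, by abel, by simp [hy], ?_⟩
  simp [hy']

lemma finrank_XX {h : V → U →ₗ[ℝ] ℝ} (hg : Gen h) (S A : Finset V) :
    (finrank ℝ (XX h S A) : ℤ) = fp (finrank ℝ U) S A := by
  unfold fp
  split_ifs with hA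
  · rw [XX_bot h S hA]; simp
  push Not at hA
  let Φ : (V → U) →ₗ[ℝ] (U × ({v // v ∉ A} → U) × ({v // v ∈ A ∩ S} → ℝ)) :=
    { toFun := fun x => (∑ v, x v, fun v => x v.1, fun v => h v.1 (x v.1))
      map_add' := fun x y => by ext <;> simp [Finset.sum_add_distrib]
      map_smul' := fun c x => by ext <;> simp [Finset.smul_sum] }
  have hΦ : ∀ x, Φ x = (∑ v, x v, fun v => x v.1, fun v => h v.1 (x v.1)) := fun x => rfl
  have hk : LinearMap.ker Φ = XX h S A := by
    ext x
    rw [LinearMap.mem_ker, mem_XX]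
    rw [hΦ]
    simp only [Prod.mk_eq_zero, funext_iff, Pi.zero_apply, Subtype.forall, Finset.mem_inter]
    constructor
    · rintro ⟨p, q, r⟩
      refine ⟨q, p, fun v hv => ?_⟩
      by_cases hvA : v ∈ A
      · exact r v ⟨hvA, hv⟩
      · simp [q v hvA]
    · rintro ⟨p, q, r⟩
      exact ⟨q, p, fun v hv => r v hv.2⟩
  have hs : LinearMap.range Φ = ⊤ := by
    rw [LinearMap.range_eq_top]
    rintro ⟨z, f, c⟩
    obtain ⟨a, b, ha, hb, hab⟩ := Finset.one_lt_card_iff.1 hA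
    have hex : ∀ v, ∃ y, v ∈ A → h v y ≠ 0 := by
      intro v
      by_cases hva : v = a
      · obtain ⟨y, _, hy⟩ := hg.indep b a (Ne.symm hab)
        exact ⟨y, fun _ => hva ▸ hy⟩
      · obtain ⟨y, _, hy⟩ := hg.indep a v (Ne.symm hva)
        exact ⟨y, fun _ => hy⟩
    choose y hy using hex
    let x0 : V → U := fun v => if hv : v ∉ A then f ⟨v, hv⟩ else
      if hS : v ∈ A ∩ S then (c ⟨v, hS⟩ / h v (y v)) • y v else 0
    obtain ⟨p, q, hpq, hp, hq⟩ := ker_split hg hab (z - ∑ v, x0 v)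
    refine ⟨x0 + Pi.single a p + Pi.single b q, ?_⟩
    have hsum : ∑ v, (x0 + Pi.single a p + Pi.single b q : V → U) v = z := by
      simp only [Pi.add_apply, Finset.sum_add_distrib, Finset.sum_pi_single', Finset.mem_univ, if_true]
      rw [add_assoc, hpq]; abel
    rw [hΦ]
    refine Prod.ext hsum (Prod.ext ?_ ?_)
    · funext v
      have h1 : v.1 ≠ a := fun e => v.2 (e ▸ ha)
      have h2 : v.1 ≠ b := fun e => v.2 (e ▸ hb)
      simp [h1, h2, x0, v.2]
    · funext v
      have hvA := (Finset.mem_inter.1 v.2).1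
      have hvS := (Finset.mem_inter.1 v.2).2
      have h0 : h v.1 (x0 v.1) = c v := by
        have := hy v.1 hvA
        simp only [x0, hvA, not_true_eq_false, dite_false, v.2, dite_true, map_smul, smul_eq_mul]
        field_simp
      have h1 : h v.1 ((Pi.single a p : V → U) v.1) = 0 := by
        by_cases e : v.1 = a
        · rw [e]; simp [hp]
        · simp [e]
      have h2 : h v.1 ((Pi.single b q : V → U) v.1) = 0 := by
        by_cases e : v.1 = b
        · rw [e]; simp [hq]
        · simp [e]
      simp only [LinearMap.pi_apply, LinearMap.comp_apply, LinearMap.proj_apply, Pi.add_apply, map_add, h0, h1, h2]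
      simp
  have := LinearMap.finrank_range_add_finrank_ker Φ
  rw [hk, hs, finrank_top] at this
  simp only [Module.finrank_prod, Module.finrank_fintype_fun_eq_card, Module.finrank_pi_fintype, Finset.sum_const, Finset.card_univ, Module.finrank_self, smul_eq_mul, Fintype.card_coe, mul_one] at this
  rw [Fintype.card_subtype_compl, Fintype.card_coe] at this
  have hle := Finset.card_le_univ A
  zify [hle] at this
  linear_combination this
end

section
set_option linter.unusedSectionVars false
set_option linter.unusedSimpArgs false
open Finset Module
variable {V : Type} [Fintype V] [DecidableEq V] {U : Type} [AddCommGroup U] [Module ℝ U] [FiniteDimensional ℝ U]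

lemma XX_le_TT (h : V → U →ₗ[ℝ] ℝ) (S : Finset V) {A : Finset V} {H : Finset (Finset V)} (hA : A ∈ H) :
    XX h S A ≤ TT h S H := le_iSup₂_of_le A hA le_rfl

lemma TT_le_iff (h : V → U →ₗ[ℝ] ℝ) (S : Finset V) {H : Finset (Finset V)} {N : Submodule ℝ (V → U)} :
    TT h S H ≤ N ↔ ∀ A ∈ H, XX h S A ≤ N := iSup₂_le_iff

lemma TT_cov (h : V → U →ₗ[ℝ] ℝ) (S : Finset V) {H P : Finset (Finset V)} (hc : Cov H P) :
    TT h S H ≤ TT h S P := by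
  rw [TT_le_iff]
  intro A hA
  obtain ⟨B, hB, hAB⟩ := hc A hA
  exact (XX_mono h S hAB).trans (XX_le_TT h S hB)

lemma TT_insert (h : V → U →ₗ[ℝ] ℝ) (S : Finset V) (A : Finset V) (H : Finset (Finset V)) :
    TT h S (insert A H) = XX h S A ⊔ TT h S H := by
  unfold TT
  rw [Finset.iSup_insert]

lemma TT_empty (h : V → U →ₗ[ℝ] ℝ) (S : Finset V) : TT h S ∅ = ⊥ := by
  rw [eq_bot_iff, TT_le_iff]; simp

lemma finrank_sup_le' {M : Type} [AddCommGroup M] [Module ℝ M] [FiniteDimensional ℝ M] (p q : Submodule ℝ M) :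
    finrank ℝ ↥(p ⊔ q) ≤ finrank ℝ p + finrank ℝ q := by
  have := Submodule.finrank_sup_add_finrank_inf_eq p q
  omega

lemma finrank_TT_le {h : V → U →ₗ[ℝ] ℝ} (hg : Gen h) (S : Finset V) (P : Finset (Finset V)) :
    (finrank ℝ (TT h S P) : ℤ) ≤ cc (finrank ℝ U) S P := by
  induction P using Finset.induction_on with
  | empty => rw [TT_empty]; simp [cc]
  | insert A P hA ih =>
    rw [TT_insert, cc, Finset.sum_insert hA]
    have h1 := finrank_sup_le' (XX h S A) (TT h S P)
    have h2 := finrank_XX hg S A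
    unfold cc at ih
    zify at h1
    linarith

lemma fp_of {D : ℕ} {S A : Finset V} (h : 2 ≤ A.card) :
    fp D S A = (D : ℤ) * A.card - D - ((A ∩ S).card : ℤ) := by
  unfold fp; rw [if_neg (by omega)]

lemma fp_zero {D : ℕ} {S A : Finset V} (h : A.card ≤ 1) : fp D S A = 0 := by
  unfold fp; rw [if_pos h]

lemma fp_nonneg {D : ℕ} (hD : 2 ≤ D) (S A : Finset V) : 0 ≤ fp D S A := by
  rcases Nat.lt_or_ge A.card 2 with h | h
  · rw [fp_zero (by omega)]
  · rw [fp_of h]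
    have : (A ∩ S).card ≤ A.card := Finset.card_le_card Finset.inter_subset_left
    zify at *
    nlinarith

lemma fp_insert {D : ℕ} {S B : Finset V} {w : V} (hw : w ∉ B) (hB : 2 ≤ B.card) :
    fp D S (insert w B) = fp D S B + (D - if w ∈ S then 1 else 0) := by
  rw [fp_of hB, fp_of (by rw [Finset.card_insert_of_notMem hw]; omega), Finset.card_insert_of_notMem hw]
  split_ifs with h
  · rw [Finset.insert_inter_of_mem h, Finset.card_insert_of_notMem (by simp [hw])]
    push_cast; ring
  · rw [Finset.insert_inter_of_notMem h]
    push_cast; ring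

lemma fp_insert_le {D : ℕ} (hD : 2 ≤ D) {S B : Finset V} {w : V} (hB : 2 ≤ B.card) :
    fp D S (insert w B) ≤ fp D S B + (D - if w ∈ S then 1 else 0) := by
  by_cases hw : w ∈ B
  · rw [Finset.insert_eq_of_mem hw]
    have : (2 : ℤ) ≤ D := by exact_mod_cast hD
    split_ifs <;> linarith
  · rw [fp_insert hw hB]

lemma fp_mono {D : ℕ} (hD : 2 ≤ D) {S A B : Finset V} (hAB : A ⊆ B) : fp D S A ≤ fp D S B := by
  rcases Nat.lt_or_ge A.card 2 with h | h
  · rw [fp_zero (by omega)]; exact fp_nonneg hD _ _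
  have hc := Finset.card_le_card hAB
  rw [fp_of h, fp_of (by omega)]
  have h1 : (B ∩ S).card ≤ (A ∩ S).card + (B \ A).card := by
    refine le_trans (Finset.card_le_card ?_) (Finset.card_union_le _ _)
    intro v hv
    simp only [Finset.mem_inter, Finset.mem_union, Finset.mem_sdiff] at *
    tauto
  have h2 : (B \ A).card + A.card = B.card := Finset.card_sdiff_add_card_eq_card hAB
  zify at *
  nlinarith

lemma fp_strict {D : ℕ} (hD : 2 ≤ D) {S A B : Finset V} (hAB : A ⊆ B) (hA : 2 ≤ A.card) (hle : fp D S B ≤ fp D S A) :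
    A = B := by
  by_contra hne
  have hs : A ⊂ B := Finset.ssubset_iff_subset_ne.2 ⟨hAB, hne⟩
  obtain ⟨w, hw, hwA⟩ := Finset.exists_of_ssubset hs
  have h1 := fp_insert (D := D) (S := S) hwA hA
  have h2 : fp D S (insert w A) ≤ fp D S B := fp_mono hD (Finset.insert_subset hw hAB)
  have : (2 : ℤ) ≤ D := by exact_mod_cast hD
  split_ifs at h1 <;> linarith

lemma cc_insert_le {D : ℕ} (hD : 2 ≤ D) (S A : Finset V) (P : Finset (Finset V)) :
    cc D S (insert A P) ≤ fp D S A + cc D S P := by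
  unfold cc
  by_cases h : A ∈ P
  · rw [Finset.insert_eq_of_mem h]; have := fp_nonneg hD S A; linarith
  · rw [Finset.sum_insert h]

lemma cc_erase {D : ℕ} {S A : Finset V} {P : Finset (Finset V)} (hA : A ∈ P) :
    cc D S (P.erase A) + fp D S A = cc D S P := Finset.sum_erase_add _ _ hA

lemma ext_cov {D : ℕ} (hD : 2 ≤ D) {S A : Finset V} {w : V} {G P : Finset (Finset V)}
    (hG : Cov G P) (hP : ∃ B ∈ P, A.erase w ⊆ B) (hw : w ∈ A) (hA : 2 ≤ A.card) :
    ∃ P', Cov (insert A G) P' ∧ cc D S P' ≤ cc D S P + (fp D S A - fp D S (A.erase w)) := by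
  obtain ⟨B, hB, hAB⟩ := hP
  have hce := Finset.card_erase_add_one hw
  rcases Nat.lt_or_ge A.card 3 with h3 | h3
  · refine ⟨insert A P, ?_, ?_⟩
    · intro C hC
      rcases Finset.mem_insert.1 hC with rfl | hC
      · exact ⟨C, Finset.mem_insert_self _ _, subset_rfl⟩
      · obtain ⟨Q, hQ, hh⟩ := hG C hC
        exact ⟨Q, Finset.mem_insert_of_mem hQ, hh⟩
    · rw [fp_zero (A := A.erase w) (by omega)]
      have := cc_insert_le hD S A P
      linarith
  · refine ⟨insert (insert w B) (P.erase B), ?_, ?_⟩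
    · intro C hC
      rcases Finset.mem_insert.1 hC with rfl | hC
      · refine ⟨_, Finset.mem_insert_self _ _, ?_⟩
        rw [← Finset.insert_erase hw]
        exact Finset.insert_subset_insert _ hAB
      · obtain ⟨Q, hQ, hh⟩ := hG C hC
        by_cases hQB : Q = B
        · exact ⟨_, Finset.mem_insert_self _ _, hh.trans (hQB ▸ Finset.subset_insert _ _)⟩
        · exact ⟨Q, Finset.mem_insert_of_mem (Finset.mem_erase.2 ⟨hQB, hQ⟩), hh⟩
    · have h1 := cc_insert_le hD S (insert w B) (P.erase B)
      have h2 := cc_erase (D := D) (S := S) hB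
      have hB2 : 2 ≤ B.card := by
        have := Finset.card_le_card hAB
        omega
      have h3 := fp_insert_le (D := D) (S := S) (w := w) hD hB2
      have h4 := fp_insert (D := D) (S := S) (w := w) (B := A.erase w) (by simp) (by omega)
      rw [Finset.insert_erase hw] at h4
      linarith
end

section
set_option linter.unusedSectionVars false
set_option linter.unusedSimpArgs false
open Finset Module
variable {V : Type} [Fintype V] [DecidableEq V] {U : Type} [AddCommGroup U] [Module ℝ U] [FiniteDimensional ℝ U]

lemma stepM {h : V → U →ₗ[ℝ] ℝ} (hg : Gen h) (hD : 2 ≤ finrank ℝ U) (S : Finset V) (H : Finset (Finset V))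
    (hP : ∃ P, Cov H P ∧ cc (finrank ℝ U) S P ≤ finrank ℝ (TT h S H)) :
    cc (finrank ℝ U) S H ≤ finrank ℝ (TT h S H) ∨
    ∃ P, P.card < H.card ∧ Cov H P ∧ TT h S P = TT h S H := by
  obtain ⟨P, hc, hP⟩ := hP
  have : ∀ A, ∃ B, A ∈ H → B ∈ P ∧ A ⊆ B := by
    intro A
    by_cases hA : A ∈ H
    · obtain ⟨B, hB⟩ := hc A hA
      exact ⟨B, fun _ => hB⟩
    · exact ⟨∅, fun h => absurd h hA⟩
  choose B hB using this
  have hcov : Cov H (H.image B) := fun A hA => ⟨B A, Finset.mem_image_of_mem _ hA, (hB A hA).2⟩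
  have hsub : H.image B ⊆ P := by
    intro C hC
    obtain ⟨A, hA, rfl⟩ := Finset.mem_image.1 hC
    exact (hB A hA).1
  have h1 : cc (finrank ℝ U) S (H.image B) ≤ cc (finrank ℝ U) S P :=
    Finset.sum_le_sum_of_subset_of_nonneg hsub (fun _ _ _ => fp_nonneg hD _ _)
  have h2 := finrank_TT_le hg S (H.image B)
  rcases lt_or_eq_of_le (Finset.card_image_le (s := H) (f := B)) with hlt | heq
  · right
    refine ⟨H.image B, hlt, hcov, ?_⟩
    symm
    apply Submodule.eq_of_le_of_finrank_le (TT_cov h S hcov)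
    zify; linarith
  · left
    have hinj := Finset.card_image_iff.1 heq
    have h3 : cc (finrank ℝ U) S (H.image B) = ∑ A ∈ H, fp (finrank ℝ U) S (B A) := by
      unfold cc
      exact Finset.sum_image hinj
    have h4 : cc (finrank ℝ U) S H ≤ ∑ A ∈ H, fp (finrank ℝ U) S (B A) :=
      Finset.sum_le_sum fun A hA => fp_mono hD (hB A hA).2
    linarith

def wt (D : ℕ) (S : Finset V) (w : V) : ℤ := D - if w ∈ S then 1 else 0

lemma fp_wt {D : ℕ} {S A : Finset V} (h : 2 ≤ A.card) : fp D S A = ∑ w ∈ A, wt D S w - D := by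
  rw [fp_of h]
  unfold wt
  rw [Finset.sum_sub_distrib, Finset.sum_ite_mem]
  simp
  ring

lemma dcount (H : Finset (Finset V)) (g : V → ℤ) :
    ∑ A ∈ H, ∑ w ∈ A, g w = ∑ w ∈ H.sup id, ((H.filter (w ∈ ·)).card : ℤ) * g w := by
  have h1 : ∀ A ∈ H, ∑ w ∈ A, g w = ∑ w ∈ H.sup id, if w ∈ A then g w else 0 := by
    intro A hA
    rw [Finset.sum_ite_mem]
    have : A ⊆ H.sup id := Finset.le_sup (f := id) hA
    rw [Finset.inter_eq_right.2 this]
  rw [Finset.sum_congr rfl h1, Finset.sum_comm]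
  refine Finset.sum_congr rfl fun w _ => ?_
  rw [← Finset.sum_filter]
  simp

lemma perv {D s g : ℤ} (hD : 4 ≤ D) (hs : 1 ≤ s) (b : Prop) [Decidable b] (hb : if b then 3 ≤ g else 2 ≤ g) :
    D * (s - 1) ≤ (s + 1) * ((g - 1) * (D - if b then 1 else 0)) - D * g := by
  split_ifs at hb ⊢ with h
  · obtain ⟨x, rfl⟩ : ∃ x, g = 3 + x := ⟨g - 3, by ring⟩
    obtain ⟨y, rfl⟩ : ∃ y, s = 1 + y := ⟨s - 1, by ring⟩
    obtain ⟨z, rfl⟩ : ∃ z, D = 4 + z := ⟨D - 4, by ring⟩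
    have hx : 0 ≤ x := by linarith
    have hy : 0 ≤ y := by linarith
    have hz : 0 ≤ z := by linarith
    have := mul_nonneg hx hy
    have := mul_nonneg hx hz
    have := mul_nonneg hy hz
    have := mul_nonneg (mul_nonneg hx hy) hz
    nlinarith
  · have : 0 ≤ D * (s * (g - 2)) := mul_nonneg (by linarith) (mul_nonneg (by linarith) (by linarith))
    nlinarith

lemma counting {D : ℕ} (hD : 4 ≤ D) (S : Finset V) (H : Finset (Finset V)) (hne : H.Nonempty)
    (h2 : ∀ A ∈ H, 2 ≤ A.card) (t : ℤ) (hk : ∀ A ∈ H, cc D S H - t ≤ fp D S A)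
    (hdeg : ∀ w ∈ H.sup id, if w ∈ S then 3 ≤ (H.filter (w ∈ ·)).card else 2 ≤ (H.filter (w ∈ ·)).card) :
    fp D S (H.sup id) ≤ t := by
  by_contra hcon
  push Not at hcon
  obtain ⟨A0, hA0, hmin⟩ := Finset.exists_min_image H Finset.card hne
  have hA2 := h2 A0 hA0
  obtain ⟨s, hs⟩ : ∃ s : ℕ, A0.card = s + 1 := ⟨A0.card - 1, by omega⟩
  have hs1 : 1 ≤ s := by omega
  have hsub : A0 ⊆ H.sup id := Finset.le_sup (f := id) hA0
  have hcard := Finset.card_le_card hsub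
  have e1 : fp D S A0 ≤ D * s := by
    rw [fp_of hA2, hs]; push_cast
    have : (0 : ℤ) ≤ ((A0 ∩ S).card : ℤ) := by positivity
    linarith
  have e2 : cc D S H = ∑ w ∈ H.sup id, ((H.filter (w ∈ ·)).card : ℤ) * wt D S w - D * H.card := by
    rw [← dcount]
    unfold cc
    rw [Finset.sum_congr rfl (fun A hA => fp_wt (h2 A hA)), Finset.sum_sub_distrib]
    simp; ring
  have e3 : fp D S (H.sup id) = ∑ w ∈ H.sup id, wt D S w - D := fp_wt (by omega)
  have e4 : ((s : ℤ) + 1) * H.card ≤ ∑ w ∈ H.sup id, ((H.filter (w ∈ ·)).card : ℤ) := by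
    have := dcount H (fun _ => 1)
    simp only [mul_one] at this
    rw [← this]
    simp only [Finset.sum_const, nsmul_eq_mul, mul_one]
    calc ((s : ℤ) + 1) * H.card = ∑ A ∈ H, ((s : ℤ) + 1) := by simp; ring
      _ ≤ _ := Finset.sum_le_sum fun A hA => by
        have := hmin A hA
        rw [hs] at this
        exact_mod_cast this
  have e5 : ∑ w ∈ H.sup id, ((D : ℤ) * (s - 1)) ≤ ∑ w ∈ H.sup id, (((s : ℤ) + 1) * ((((H.filter (w ∈ ·)).card : ℤ) - 1) * wt D S w) - D * ((H.filter (w ∈ ·)).card : ℤ)) := by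
    refine Finset.sum_le_sum fun w hw => ?_
    unfold wt
    refine perv (by exact_mod_cast hD) (by exact_mod_cast hs1) (w ∈ S) ?_
    have := hdeg w hw
    split_ifs at this ⊢ <;> exact_mod_cast this
  simp only [sub_mul, one_mul] at e5
  simp only [Finset.sum_sub_distrib, ← Finset.mul_sum, Finset.sum_const, nsmul_eq_mul] at e5
  have e6 := hk A0 hA0
  have e7 : ((s : ℤ) + 1) * (D * (s - 1)) ≤ ((H.sup id).card : ℤ) * (D * (s - 1)) := by
    apply mul_le_mul_of_nonneg_right
    · rw [hs] at hcard; exact_mod_cast hcard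
    · apply mul_nonneg (by positivity)
      have : (1 : ℤ) ≤ s := by exact_mod_cast hs1
      linarith
  generalize (∑ w ∈ H.sup id, ((H.filter (w ∈ ·)).card : ℤ) * wt D S w) = a at *
  generalize (∑ w ∈ H.sup id, wt D S w) = b at *
  generalize (∑ w ∈ H.sup id, ((H.filter (w ∈ ·)).card : ℤ)) = c at *
  have e8 : a - b ≤ D * s + D * H.card - D - 1 := by linarith
  have e9 := mul_le_mul_of_nonneg_left e8 (show (0 : ℤ) ≤ s + 1 by positivity)
  have e10 := mul_le_mul_of_nonneg_left e4 (show (0 : ℤ) ≤ D by positivity)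
  nlinarith
end

section
set_option linter.unusedSectionVars false
set_option linter.unusedSimpArgs false
open Finset Module
variable {V : Type} [Fintype V] [DecidableEq V] {U : Type} [AddCommGroup U] [Module ℝ U] [FiniteDimensional ℝ U]

lemma sup_step {M : Type} [AddCommGroup M] [Module ℝ M] [FiniteDimensional ℝ M] (N X Y : Submodule ℝ M)
    (hh : N ⊓ X ≤ Y) : finrank ℝ N + finrank ℝ X ≤ finrank ℝ ↥(N ⊔ X) + finrank ℝ Y := by
  have h1 := Submodule.finrank_sup_add_finrank_inf_eq N X
  have h2 := Submodule.finrank_mono hh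
  omega

lemma XX_ker {h : V → U →ₗ[ℝ] ℝ} {S A : Finset V} {w : V} {x : V → U} (hx : x ∈ XX h S A) (hw : x w = 0) :
    x ∈ XX h S (A.erase w) := by
  refine ⟨fun v hv => ?_, hx.2⟩
  by_cases e : v = w
  · rw [e, hw]
  · exact hx.1 v (fun hA => hv (Finset.mem_erase.2 ⟨e, hA⟩))

lemma TT_ev {h : V → U →ₗ[ℝ] ℝ} {S : Finset V} {H : Finset (Finset V)} {w : V} (hw : ∀ A ∈ H, w ∉ A)
    {x : V → U} (hx : x ∈ TT h S H) : x w = 0 := by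
  have : TT h S H ≤ LinearMap.ker (LinearMap.proj w : (V → U) →ₗ[ℝ] U) := by
    rw [TT_le_iff]
    intro A hA y hy
    exact hy.1 w (hw A hA)
  exact this hx

lemma XX_erase_S (h : V → U →ₗ[ℝ] ℝ) (S : Finset V) {A : Finset V} {w : V} (hw : w ∉ A) :
    XX h (S.erase w) A = XX h S A := by
  ext x
  simp only [mem_XX, Finset.mem_erase]
  refine and_congr_right fun h1 => and_congr_right fun _ => ⟨fun h3 v hv => ?_, fun h3 v hv => h3 v hv.2⟩
  by_cases e : v = w
  · rw [h1 v (e ▸ hw)]; simp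
  · exact h3 v ⟨e, hv⟩

lemma TT_erase_S (h : V → U →ₗ[ℝ] ℝ) (S : Finset V) {H : Finset (Finset V)} {w : V} (hw : ∀ A ∈ H, w ∉ A) :
    TT h (S.erase w) H = TT h S H := by
  unfold TT
  exact iSup_congr fun A => iSup_congr fun hA => XX_erase_S h S (hw A hA)

lemma XX_S_le (h : V → U →ₗ[ℝ] ℝ) (S : Finset V) (A : Finset V) (w : V) :
    XX h S A ≤ XX h (S.erase w) A := fun _ hx => ⟨hx.1, hx.2.1, fun v hv => hx.2.2 v (Finset.mem_of_mem_erase hv)⟩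

/-- degree one -/
lemma deg1 {h : V → U →ₗ[ℝ] ℝ} (hg : Gen h) (S : Finset V) {H0 : Finset (Finset V)} {w : V} {A1 : Finset V}
    (hw : ∀ A ∈ H0, w ∉ A) :
    (finrank ℝ (TT h S (insert (A1.erase w) H0)) : ℤ) + (fp (finrank ℝ U) S A1 - fp (finrank ℝ U) S (A1.erase w))
      ≤ finrank ℝ (TT h S (insert A1 H0)) := by
  have hs := sup_step (TT h S (insert (A1.erase w) H0)) (XX h S A1) (XX h S (A1.erase w)) (by
    rintro x ⟨hx1, hx2⟩
    refine XX_ker hx2 (TT_ev ?_ hx1)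
    intro A hA
    rcases Finset.mem_insert.1 hA with rfl | hA
    · simp
    · exact hw A hA)
  have hle : TT h S (insert (A1.erase w) H0) ⊔ XX h S A1 ≤ TT h S (insert A1 H0) := by
    rw [TT_insert, TT_insert]
    refine sup_le (sup_le_sup_right (XX_mono h S (Finset.erase_subset _ _)) _) le_sup_left
  have := Submodule.finrank_mono hle
  have e1 := finrank_XX hg S A1
  have e2 := finrank_XX hg S (A1.erase w)
  zify at *
  linarith

/-- degree two, rigid case -/
lemma deg2 {h : V → U →ₗ[ℝ] ℝ} (hg : Gen h) (S : Finset V) {H0 : Finset (Finset V)} {w : V} {A1 A2 : Finset V}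
    (hw : ∀ A ∈ H0, w ∉ A)
    (hz : ∀ x1 ∈ XX h (S.erase w) A1, ∀ x2 ∈ XX h (S.erase w) A2, x1 + x2 ∈ TT h (S.erase w) H0 → x1 w = 0) :
    (finrank ℝ (TT h S (insert (A1.erase w) (insert (A2.erase w) H0))) : ℤ)
      + (fp (finrank ℝ U) S A1 - fp (finrank ℝ U) S (A1.erase w))
      + (fp (finrank ℝ U) S A2 - fp (finrank ℝ U) S (A2.erase w))
      ≤ finrank ℝ (TT h S (insert A1 (insert A2 H0))) := by
  set N := TT h S (insert (A1.erase w) (insert (A2.erase w) H0)) with hN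
  have hNw : ∀ x ∈ N, x w = 0 := by
    intro x hx
    refine TT_ev ?_ hx
    intro A hA
    rcases Finset.mem_insert.1 hA with rfl | hA
    · simp
    rcases Finset.mem_insert.1 hA with rfl | hA
    · simp
    · exact hw A hA
  have hs := sup_step N (XX h S A1) (XX h S (A1.erase w)) (by
    rintro x ⟨hx1, hx2⟩
    exact XX_ker hx2 (hNw x hx1))
  have hs2 := sup_step (N ⊔ XX h S A1) (XX h S A2) (XX h S (A2.erase w)) (by
    rintro x ⟨hx1, hx2⟩
    refine XX_ker hx2 ?_
    obtain ⟨n, hn, x1, hx3, rfl⟩ := Submodule.mem_sup.1 hx1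
    have hn' := hn
    rw [hN, TT_insert, TT_insert] at hn'
    obtain ⟨a1, ha1, n', hn2, rfl⟩ := Submodule.mem_sup.1 hn'
    obtain ⟨a2, ha2, n0, hn0, rfl⟩ := Submodule.mem_sup.1 hn2
    have ha1' := XX_mono h S (Finset.erase_subset w A1) ha1
    have ha2' := XX_mono h S (Finset.erase_subset w A2) ha2
    have := hz (a1 + x1) (XX_S_le h S A1 w (add_mem ha1' hx3)) (a2 - (a1 + (a2 + n0) + x1))
      (XX_S_le h S A2 w (sub_mem ha2' hx2)) (by
        rw [TT_erase_S h S hw]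
        have e : a1 + x1 + (a2 - (a1 + (a2 + n0) + x1)) = - n0 := by abel
        rw [e]; exact neg_mem hn0)
    have ha1w : a1 w = 0 := ha1.1 w (by simp)
    have hx1w : x1 w = 0 := by simpa [ha1w] using this
    rw [Pi.add_apply, hNw _ hn, hx1w, add_zero])
  have hle : N ⊔ XX h S A1 ⊔ XX h S A2 ≤ TT h S (insert A1 (insert A2 H0)) := by
    refine sup_le (sup_le ?_ (XX_le_TT h S (by simp))) (XX_le_TT h S (by simp))
    refine TT_cov h S ?_
    intro A hA
    rcases Finset.mem_insert.1 hA with rfl | hA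
    · exact ⟨A1, by simp, Finset.erase_subset _ _⟩
    rcases Finset.mem_insert.1 hA with rfl | hA
    · exact ⟨A2, by simp, Finset.erase_subset _ _⟩
    · exact ⟨A, by simp [hA], subset_rfl⟩
  have := Submodule.finrank_mono hle
  have e1 := finrank_XX hg S A1
  have e2 := finrank_XX hg S (A1.erase w)
  have e3 := finrank_XX hg S A2
  have e4 := finrank_XX hg S (A2.erase w)
  zify at *
  linarith

/-- degree two, flexible case -/
lemma deg2' {h : V → U →ₗ[ℝ] ℝ} (S : Finset V) {H0 : Finset (Finset V)} {w : V} {A1 A2 : Finset V}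
    (hw : ∀ A ∈ H0, w ∉ A) {x1 x2 : V → U}
    (h1 : x1 ∈ XX h (S.erase w) A1) (h2 : x2 ∈ XX h (S.erase w) A2) (h12 : x1 + x2 ∈ TT h (S.erase w) H0)
    (hne : h w (x1 w) ≠ 0) :
    (finrank ℝ (TT h (S.erase w) (insert A1 (insert A2 H0))) : ℤ)
      ≤ finrank ℝ (TT h S (insert A1 (insert A2 H0))) + 1 := by
  have hx2 : h w (x2 w) = - h w (x1 w) := by
    have := TT_ev hw h12
    rw [Pi.add_apply] at this
    rw [← map_neg, eq_neg_of_add_eq_zero_right this]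
  have key : ∀ (A : Finset V) (x y : V → U), x ∈ XX h (S.erase w) A → y ∈ XX h (S.erase w) A →
      h w (x w) ≠ 0 → y - (h w (y w) / h w (x w)) • x ∈ XX h S A := by
    intro A x y hx hy hxw
    have hm := sub_mem hy (Submodule.smul_mem _ (h w (y w) / h w (x w)) hx)
    refine ⟨hm.1, hm.2.1, fun v hv => ?_⟩
    by_cases e : v = w
    · subst e
      simp [hxw]
    · exact hm.2.2 v (Finset.mem_erase.2 ⟨e, hv⟩)
  rw [TT_erase_S h S hw] at h12
  set T := TT h S (insert A1 (insert A2 H0)) with hT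
  have hX1 : XX h S A1 ≤ T := XX_le_TT h S (by simp)
  have hX2 : XX h S A2 ≤ T := XX_le_TT h S (by simp)
  have hX0 : TT h S H0 ≤ T := TT_cov h S (fun A hA => ⟨A, by simp [hA], subset_rfl⟩)
  have hx1s : x1 ∈ T ⊔ Submodule.span ℝ {x1} := Submodule.mem_sup_right (Submodule.mem_span_singleton_self _)
  have hx2s : x2 ∈ T ⊔ Submodule.span ℝ {x1} := by
    have : x2 = (x1 + x2) - x1 := by abel
    rw [this]
    exact sub_mem (Submodule.mem_sup_left (hX0 h12)) hx1s
  have hle : TT h (S.erase w) (insert A1 (insert A2 H0)) ≤ T ⊔ Submodule.span ℝ {x1} := by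
    rw [TT_insert, TT_insert, TT_erase_S h S hw]
    refine sup_le ?_ (sup_le ?_ (hX0.trans le_sup_left))
    · intro y hy
      have := add_mem (Submodule.mem_sup_left (hX1 (key A1 x1 y h1 hy hne))) (Submodule.smul_mem _ (h w (y w) / h w (x1 w)) hx1s)
      simpa using this
    · intro y hy
      have := add_mem (Submodule.mem_sup_left (hX2 (key A2 x2 y h2 hy (by rw [hx2]; simpa using hne)))) (Submodule.smul_mem _ (h w (y w) / h w (x2 w)) hx2s)
      simpa using this
  have a1 := Submodule.finrank_mono hle
  have a2 := finrank_sup_le' T (Submodule.span ℝ {x1})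
  have a3 : finrank ℝ (Submodule.span ℝ {x1}) ≤ 1 := (finrank_span_le_card {x1}).trans (by simp)
  zify at *
  linarith

lemma cc_erase_S {D : ℕ} {S : Finset V} {w : V} (hw : w ∈ S) {P : Finset (Finset V)} {B : Finset V} (hB : B ∈ P)
    (hB2 : 2 ≤ B.card) (hwB : w ∈ B) : cc D S P + 1 ≤ cc D (S.erase w) P := by
  have hmono : ∀ C, fp D S C ≤ fp D (S.erase w) C := by
    intro C
    rcases Nat.lt_or_ge C.card 2 with h | h
    · rw [fp_zero (by omega), fp_zero (by omega)]
    · rw [fp_of h, fp_of h]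
      have : (C ∩ S.erase w).card ≤ (C ∩ S).card :=
        Finset.card_le_card (Finset.inter_subset_inter_left (Finset.erase_subset _ _))
      zify at this
      linarith
  have hB' : fp D S B + 1 = fp D (S.erase w) B := by
    rw [fp_of hB2, fp_of hB2]
    have : (B ∩ S.erase w).card + 1 = (B ∩ S).card := by
      rw [Finset.inter_erase, Finset.card_erase_add_one (by simp [hw, hwB])]
    zify at this
    linarith
  rw [← cc_erase hB, ← cc_erase hB]
  have : cc D S (P.erase B) ≤ cc D (S.erase w) (P.erase B) := Finset.sum_le_sum fun C _ => hmono C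
  linarith
end

section
set_option linter.unusedSectionVars false
set_option linter.unusedSimpArgs false
open Finset Module
variable {V : Type} [Fintype V] [DecidableEq V] {U : Type} [AddCommGroup U] [Module ℝ U] [FiniteDimensional ℝ U]

lemma Cov_trans {H P Q : Finset (Finset V)} (h1 : Cov H P) (h2 : Cov P Q) : Cov H Q := by
  intro A hA
  obtain ⟨B, hB, hAB⟩ := h1 A hA
  obtain ⟨C, hC, hBC⟩ := h2 B hB
  exact ⟨C, hC, hAB.trans hBC⟩

lemma sup_lt {H H' : Finset (Finset V)} {w : V} (hw : w ∈ H.sup id) (hc : Cov H' H) (hn : ∀ A ∈ H', w ∉ A) :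
    (H'.sup id).card < (H.sup id).card := by
  apply Finset.card_lt_card
  refine Finset.ssubset_iff_subset_ne.2 ⟨?_, ?_⟩
  · intro v hv
    obtain ⟨A, hA, hv⟩ := Finset.mem_sup.1 hv
    obtain ⟨B, hB, hAB⟩ := hc A hA
    exact Finset.mem_sup.2 ⟨B, hB, hAB hv⟩
  · intro e
    rw [← e] at hw
    obtain ⟨A, hA, hv⟩ := Finset.mem_sup.1 hw
    exact hn A hA hv

theorem main_cover {h : V → U →ₗ[ℝ] ℝ} (hg : Gen h) (hD : 4 ≤ finrank ℝ U) (n : ℕ) :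
    ∀ (m : ℕ) (H : Finset (Finset V)) (S : Finset V), H.card ≤ n → S.card + (H.sup id).card < m →
      ∃ P, Cov H P ∧ cc (finrank ℝ U) S P ≤ finrank ℝ (TT h S H) := by
  have hD2 : 2 ≤ finrank ℝ U := by omega
  induction n with
  | zero =>
    intro m H S hH _
    have : H = ∅ := Finset.card_eq_zero.1 (by omega)
    subst this
    exact ⟨∅, by intro A hA; simp at hA, by simp [cc]⟩
  | succ n ihn =>
    intro m
    induction m with
    | zero => intro H S _ hm; omega
    | succ m ihm =>
    intro H S hH hm
    have ihn' : ∀ (H : Finset (Finset V)) (S : Finset V), H.card ≤ n →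
      ∃ P, Cov H P ∧ cc (finrank ℝ U) S P ≤ finrank ℝ (TT h S H) := fun H S hh => ihn _ H S hh (Nat.lt_succ_self _)
    rcases H.eq_empty_or_nonempty with rfl | hne
    · exact ihn' ∅ S (by simp)
    -- small blocks
    by_cases hsm : ∃ A ∈ H, A.card ≤ 1
    · obtain ⟨A, hA, hA1⟩ := hsm
      have hc := Finset.card_erase_add_one hA
      obtain ⟨P, hP, hP2⟩ := ihn' (H.erase A) S (by omega)
      refine ⟨insert A P, ?_, ?_⟩
      · intro C hC
        by_cases e : C = A
        · exact ⟨A, by simp, by rw [e]⟩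
        · obtain ⟨B, hB, h'⟩ := hP C (Finset.mem_erase.2 ⟨e, hC⟩)
          exact ⟨B, by simp [hB], h'⟩
      · have h1 := cc_insert_le hD2 S A P
        rw [fp_zero hA1] at h1
        have h2 := Submodule.finrank_mono (TT_cov h S (H := H.erase A) (P := H)
          (fun A hA => ⟨A, Finset.mem_of_mem_erase hA, subset_rfl⟩))
        zify at h2
        linarith
    push Not at hsm
    have h2 : ∀ A ∈ H, 2 ≤ A.card := fun A hA => hsm A hA
    -- step M
    by_cases hred : ∃ A0 ∈ H, ∃ P, P.card < (H.erase A0).card ∧ Cov (H.erase A0) P ∧ TT h S P = TT h S (H.erase A0)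
    · obtain ⟨A0, hA0, P, hPc, hPcov, hPT⟩ := hred
      have hc := Finset.card_erase_add_one hA0
      obtain ⟨Q, hQ, hQ2⟩ := ihn' (insert A0 P) S (by have := Finset.card_insert_le A0 P; omega)
      refine ⟨Q, Cov_trans ?_ hQ, ?_⟩
      · intro C hC
        by_cases e : C = A0
        · exact ⟨A0, by simp, by rw [e]⟩
        · obtain ⟨B, hB, h'⟩ := hPcov C (Finset.mem_erase.2 ⟨e, hC⟩)
          exact ⟨B, by simp [hB], h'⟩
      · rw [TT_insert, hPT, ← TT_insert, Finset.insert_erase hA0] at hQ2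
        exact hQ2
    have hkap : ∀ A ∈ H, cc (finrank ℝ U) S H - finrank ℝ (TT h S H) ≤ fp (finrank ℝ U) S A := by
      intro A hA
      have hc := Finset.card_erase_add_one hA
      rcases stepM hg hD2 S (H.erase A) (ihn' (H.erase A) S (by omega)) with h1 | h1
      · have h3 := cc_erase (D := finrank ℝ U) (S := S) hA
        have h2 := Submodule.finrank_mono (TT_cov h S (H := H.erase A) (P := H)
          (fun A hA => ⟨A, Finset.mem_of_mem_erase hA, subset_rfl⟩))
        zify at h2
        linarith
      · exact absurd ⟨A, hA, h1⟩ hred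
    by_cases hdeg : ∀ w ∈ H.sup id, if w ∈ S then 3 ≤ (H.filter (w ∈ ·)).card else 2 ≤ (H.filter (w ∈ ·)).card
    · refine ⟨{H.sup id}, fun A hA => ⟨_, Finset.mem_singleton_self _, Finset.le_sup (f := id) hA⟩, ?_⟩
      have := counting hD S H hne h2 _ hkap hdeg
      simpa [cc] using this
    push Not at hdeg
    obtain ⟨w, hw, hdw⟩ := hdeg
    obtain ⟨A1, hA1, hwA1⟩ := Finset.mem_sup.1 hw
    simp only [id] at hwA1
    have hpos : 0 < (H.filter (w ∈ ·)).card := Finset.card_pos.2 ⟨A1, by simp [hA1, hwA1]⟩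
    by_cases hd1 : (H.filter (w ∈ ·)).card = 1
    · -- degree one
      have h0 : ∀ A ∈ H.erase A1, w ∉ A := by
        intro A hA hwA
        obtain ⟨B, hB⟩ := Finset.card_eq_one.1 hd1
        have m1 : A1 ∈ H.filter (w ∈ ·) := by simp [hA1, hwA1]
        have m2 : A ∈ H.filter (w ∈ ·) := by simp [Finset.mem_of_mem_erase hA, hwA]
        rw [hB, Finset.mem_singleton] at m1 m2
        exact Finset.ne_of_mem_erase hA (m2.trans m1.symm)
      have hcard := Finset.card_erase_add_one hA1
      have hlt := sup_lt (H' := insert (A1.erase w) (H.erase A1)) hw (by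
        intro A hA
        rcases Finset.mem_insert.1 hA with rfl | hA
        · exact ⟨A1, hA1, Finset.erase_subset _ _⟩
        · exact ⟨A, Finset.mem_of_mem_erase hA, subset_rfl⟩) (by
        intro A hA
        rcases Finset.mem_insert.1 hA with rfl | hA
        · simp
        · exact h0 A hA)
      obtain ⟨P, hP, hP2⟩ := ihm (insert (A1.erase w) (H.erase A1)) S
        (by have := Finset.card_insert_le (A1.erase w) (H.erase A1); omega) (by omega)
      obtain ⟨Q, hQ, hQ2⟩ := ext_cov (D := finrank ℝ U) hD2 (S := S) (A := A1) (w := w) (G := H.erase A1) (P := P)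
        (fun A hA => hP A (Finset.mem_insert_of_mem hA)) (hP _ (Finset.mem_insert_self _ _)) hwA1 (h2 A1 hA1)
      have := deg1 hg S (A1 := A1) h0
      rw [Finset.insert_erase hA1] at hQ this
      exact ⟨Q, hQ, by linarith⟩
    · -- rod of degree two
      have hwS : w ∈ S := by
        by_contra hn
        rw [if_neg hn] at hdw
        omega
      rw [if_pos hwS] at hdw
      obtain ⟨A2, hA2, hwA2, h12⟩ : ∃ A2 ∈ H, w ∈ A2 ∧ A2 ≠ A1 := by
        by_contra hcon
        push Not at hcon
        apply hd1
        rw [Finset.card_eq_one]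
        refine ⟨A1, ?_⟩
        ext A
        simp only [Finset.mem_filter, Finset.mem_singleton]
        exact ⟨fun hh => hcon A hh.1 hh.2, fun hh => hh ▸ ⟨hA1, hwA1⟩⟩
      set H0 := (H.erase A1).erase A2 with hH0
      have hA2' : A2 ∈ H.erase A1 := Finset.mem_erase.2 ⟨h12, hA2⟩
      have hHeq : insert A1 (insert A2 H0) = H := by
        rw [hH0, Finset.insert_erase hA2', Finset.insert_erase hA1]
      have h0 : ∀ A ∈ H0, w ∉ A := by
        intro A hA hwA
        have m0 := Finset.mem_of_mem_erase (Finset.mem_of_mem_erase hA)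
        have n2 := Finset.ne_of_mem_erase hA
        have n1 := Finset.ne_of_mem_erase (Finset.mem_of_mem_erase hA)
        have : ({A, A1, A2} : Finset (Finset V)) ⊆ H.filter (w ∈ ·) := by
          intro B hB
          simp only [Finset.mem_insert, Finset.mem_singleton] at hB
          rcases hB with rfl | rfl | rfl <;> simp [*]
        have := Finset.card_le_card this
        rw [Finset.card_insert_of_notMem (by simp [n1, n2]), Finset.card_insert_of_notMem (by simp [h12.symm]), Finset.card_singleton] at this
        omega
      by_cases hflex : ∃ x1 ∈ XX h (S.erase w) A1, ∃ x2 ∈ XX h (S.erase w) A2, x1 + x2 ∈ TT h (S.erase w) H0 ∧ x1 w ≠ 0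
      · obtain ⟨x1, hx1, x2, hx2, hx12, hxw⟩ := hg.gen (S.erase w) w (by simp) A1 A2 H0 hflex
        have hd := deg2' S h0 hx1 hx2 hx12 hxw
        rw [hHeq] at hd
        have hc := Finset.card_erase_add_one hwS
        obtain ⟨P, hP, hP2⟩ := ihm H (S.erase w) hH (by omega)
        refine ⟨P, hP, ?_⟩
        obtain ⟨B, hB, hAB⟩ := hP A1 hA1
        have := cc_erase_S (D := finrank ℝ U) hwS hB ((h2 A1 hA1).trans (Finset.card_le_card hAB)) (hAB hwA1)
        linarith
      · push Not at hflex
        have hd := deg2 hg S h0 hflex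
        rw [hHeq] at hd
        have hcard1 := Finset.card_erase_add_one hA1
        have hcard2 := Finset.card_erase_add_one hA2'
        rw [← hH0] at hcard2
        have hlt := sup_lt (H' := insert (A1.erase w) (insert (A2.erase w) H0)) hw (by
          intro A hA
          rcases Finset.mem_insert.1 hA with rfl | hA
          · exact ⟨A1, hA1, Finset.erase_subset _ _⟩
          rcases Finset.mem_insert.1 hA with rfl | hA
          · exact ⟨A2, hA2, Finset.erase_subset _ _⟩
          · exact ⟨A, Finset.mem_of_mem_erase (Finset.mem_of_mem_erase hA), subset_rfl⟩) (by
          intro A hA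
          rcases Finset.mem_insert.1 hA with rfl | hA
          · simp
          rcases Finset.mem_insert.1 hA with rfl | hA
          · simp
          · exact h0 A hA)
        obtain ⟨P, hP, hP2⟩ := ihm (insert (A1.erase w) (insert (A2.erase w) H0)) S
          (by have := Finset.card_insert_le (A1.erase w) (insert (A2.erase w) H0)
              have := Finset.card_insert_le (A2.erase w) H0; omega) (by omega)
        obtain ⟨Q, hQ, hQ2⟩ := ext_cov (D := finrank ℝ U) hD2 (S := S) (A := A2) (w := w)
          (G := insert (A1.erase w) H0) (P := P)
          (fun A hA => hP A (by simp only [Finset.mem_insert] at hA ⊢; tauto)) (hP _ (by simp)) hwA2 (h2 A2 hA2)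
        obtain ⟨Q', hQ', hQ2'⟩ := ext_cov (D := finrank ℝ U) hD2 (S := S) (A := A1) (w := w)
          (G := insert A2 H0) (P := Q)
          (fun A hA => hQ A (by simp only [Finset.mem_insert] at hA ⊢; tauto)) (hQ _ (by simp)) hwA1 (h2 A1 hA1)
        rw [hHeq] at hQ'
        exact ⟨Q', hQ', by linarith⟩
end

section
set_option linter.unusedSectionVars false
set_option linter.unusedSimpArgs false
open Finset Module Topology

lemma exists_locmax {X I : Type} [TopologicalSpace X] [Nonempty X] [Fintype I] (ρ : I → X → ℕ) (N : ℕ)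
    (hN : ∀ i x, ρ i x ≤ N) (hl : ∀ i n, IsOpen {x | n ≤ ρ i x}) :
    ∃ x, ∀ i, ∀ᶠ x' in 𝓝 x, ρ i x' ≤ ρ i x := by
  have hb : ∃ x, ∀ x', ∑ i, ρ i x' ≤ ∑ i, ρ i x := by
    have hbd : BddAbove (Set.range fun x => ∑ i, ρ i x) := by
      refine ⟨∑ i : I, N, ?_⟩
      rintro _ ⟨x, rfl⟩
      exact Finset.sum_le_sum fun i _ => hN i x
    obtain ⟨x, hx⟩ := Nat.sSup_mem (Set.range_nonempty _) hbd
    exact ⟨x, fun x' => by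
      have := le_csSup hbd ⟨x', rfl⟩
      rw [← hx] at this
      exact this⟩
  obtain ⟨x, hx⟩ := hb
  refine ⟨x, fun i => ?_⟩
  have h1 : ∀ᶠ x' in 𝓝 x, ∀ j, ρ j x ≤ ρ j x' :=
    Filter.eventually_all.2 fun j => (hl j (ρ j x)).mem_nhds (le_refl (ρ j x))
  filter_upwards [h1] with x' hx'
  by_contra hc
  push Not at hc
  have := Finset.sum_lt_sum (fun j _ => hx' j) ⟨i, Finset.mem_univ i, hc⟩
  exact absurd (hx x') (not_le.2 this)

lemma lsc_rank {X E F : Type} [TopologicalSpace X] [NormedAddCommGroup E] [NormedSpace ℝ E] [FiniteDimensional ℝ E]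
    [NormedAddCommGroup F] [NormedSpace ℝ F] [FiniteDimensional ℝ F] (Φ : X → E →ₗ[ℝ] F)
    (hc : ∀ y, Continuous fun x => Φ x y) (n : ℕ) : IsOpen {x | n ≤ finrank ℝ (LinearMap.range (Φ x))} := by
  have h1 : Continuous fun x => LinearMap.toContinuousLinearMap (Φ x) := by
    rw [continuous_clm_apply]
    exact hc
  have h2 := (isOpen_setOfPred_nat_le_rank (𝕜 := ℝ) (E := E) (F := F) n).preimage h1
  convert h2 using 1
  ext x
  have e : LinearMap.rank (↑(LinearMap.toContinuousLinearMap (Φ x)) : E →ₗ[ℝ] F) = (finrank ℝ (LinearMap.range (Φ x)) : ℕ) := by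
    rw [finrank_eq_rank']; rfl
  change _ ↔ (n : Cardinal) ≤ LinearMap.rank (↑(LinearMap.toContinuousLinearMap (Φ x)) : E →ₗ[ℝ] F)
  rw [e, Nat.cast_le]
  rfl

variable {V : Type} [Fintype V] [DecidableEq V]

section
variable {U : Type} [AddCommGroup U] [Module ℝ U]

def fam (A1 A2 : Finset V) (H0 : Finset (Finset V)) : Option (Option (Finset V)) → Finset V
  | none => A1
  | some none => A2
  | some (some A) => if A ∈ H0 then A else ∅

def PhiMap (h : V → U →ₗ[ℝ] ℝ) (S : Finset V) (w : V) (A1 A2 : Finset V) (H0 : Finset (Finset V)) :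
    (Option (Option (Finset V)) → V → U) →ₗ[ℝ]
      ((Option (Option (Finset V)) → V → U) × (Option (Option (Finset V)) → U) ×
        (Option (Option (Finset V)) → V → ℝ) × (V → U) × ℝ) where
  toFun x := (fun i v => if v ∈ fam A1 A2 H0 i then 0 else x i v, fun i => ∑ v, x i v,
    fun i v => if v ∈ S then h v (x i v) else 0, ∑ i, x i, h w (x none w))
  map_add' x y := by
    refine Prod.ext ?_ (Prod.ext ?_ (Prod.ext ?_ (Prod.ext ?_ ?_)))
    · funext i v; dsimp; split_ifs <;> simp
    · funext i; simp [Finset.sum_add_distrib]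
    · funext i v; dsimp; split_ifs <;> simp
    · simp [Finset.sum_add_distrib]
    · simp
  map_smul' c x := by
    refine Prod.ext ?_ (Prod.ext ?_ (Prod.ext ?_ (Prod.ext ?_ ?_)))
    · funext i v; dsimp; split_ifs <;> simp
    · funext i; simp [Finset.smul_sum]
    · funext i v; dsimp; split_ifs <;> simp
    · simp [Finset.smul_sum]
    · simp

def Kset (h : V → U →ₗ[ℝ] ℝ) (S : Finset V) (A1 A2 : Finset V) (H0 : Finset (Finset V))
    (x : Option (Option (Finset V)) → V → U) : Prop :=
  (∀ i, x i ∈ XX h S (fam A1 A2 H0 i)) ∧ ∑ i, x i = 0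

lemma mem_ker_Phi (h : V → U →ₗ[ℝ] ℝ) (S : Finset V) (w : V) (A1 A2 : Finset V) (H0 : Finset (Finset V))
    (x : Option (Option (Finset V)) → V → U) :
    x ∈ LinearMap.ker (PhiMap h S w A1 A2 H0) ↔ Kset h S A1 A2 H0 x ∧ h w (x none w) = 0 := by
  rw [LinearMap.mem_ker]
  change ((_, _, _, _, _) : (Option (Option (Finset V)) → V → U) × (Option (Option (Finset V)) → U) ×
        (Option (Option (Finset V)) → V → ℝ) × (V → U) × ℝ) = 0 ↔ _
  simp only [Prod.mk_eq_zero]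
  unfold Kset
  constructor
  · rintro ⟨h1, h2, h3, h4, h5⟩
    refine ⟨⟨fun i => ⟨fun v hv => ?_, ?_, fun v hv => ?_⟩, h4⟩, h5⟩
    · have := congrFun (congrFun h1 i) v
      simpa [hv] using this
    · exact congrFun h2 i
    · have := congrFun (congrFun h3 i) v
      simpa [hv] using this
  · rintro ⟨⟨h1, h2⟩, h3⟩
    refine ⟨?_, ?_, ?_, h2, h3⟩
    · funext i v
      split_ifs with hv
      · rfl
      · exact (h1 i).1 v hv
    · funext i
      exact (h1 i).2.1
    · funext i v
      split_ifs with hv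
      · exact (h1 i).2.2 v hv
      · rfl

lemma Kset_iff [FiniteDimensional ℝ U] (h : V → U →ₗ[ℝ] ℝ) (S : Finset V) (A1 A2 : Finset V) (H0 : Finset (Finset V)) (x1 : V → U) :
    (∃ x, Kset h S A1 A2 H0 x ∧ x none = x1) ↔
      x1 ∈ XX h S A1 ∧ ∃ x2 ∈ XX h S A2, x1 + x2 ∈ TT h S H0 := by
  constructor
  · rintro ⟨x, ⟨hx, hs⟩, rfl⟩
    refine ⟨hx none, x (some none), hx (some none), ?_⟩
    rw [Fintype.sum_option, Fintype.sum_option, ← add_assoc] at hs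
    rw [eq_neg_of_add_eq_zero_left hs]
    refine neg_mem (sum_mem fun A _ => ?_)
    have := hx (some (some A))
    simp only [fam] at this
    split_ifs at this with hA
    · exact XX_le_TT h S hA this
    · rw [XX_bot h S (by simp), Submodule.mem_bot] at this
      rw [this]; exact zero_mem _
  · rintro ⟨h1, x2, h2, h12⟩
    unfold TT at h12
    rw [Submodule.mem_iSup_finset_iff_exists_sum] at h12
    obtain ⟨μ, hμ⟩ := h12
    refine ⟨fun i => match i with
      | none => x1
      | some none => x2
      | some (some A) => if hA : A ∈ H0 then - (μ A : V → U) else 0, ⟨?_, ?_⟩, rfl⟩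
    · rintro (_ | _ | A)
      · exact h1
      · exact h2
      · dsimp [fam]
        split_ifs with hA
        · exact neg_mem (μ A).2
        · exact zero_mem _
    · rw [Fintype.sum_option, Fintype.sum_option, ← add_assoc]
      dsimp
      rw [← hμ, Finset.sum_ite_mem]
      simp
end

lemma rank_lt {E F : Type} [AddCommGroup E] [Module ℝ E] [FiniteDimensional ℝ E] [AddCommGroup F] [Module ℝ F]
    (f g : E →ₗ[ℝ] F) (hlt : LinearMap.ker g < LinearMap.ker f) :
    finrank ℝ (LinearMap.range f) < finrank ℝ (LinearMap.range g) := by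
  have h1 := LinearMap.finrank_range_add_finrank_ker f
  have h2 := LinearMap.finrank_range_add_finrank_ker g
  have h3 := Submodule.finrank_lt_finrank_of_lt hlt
  omega

lemma rank_le_dom {E F : Type} [AddCommGroup E] [Module ℝ E] [FiniteDimensional ℝ E] [AddCommGroup F] [Module ℝ F]
    (f : E →ₗ[ℝ] F) : finrank ℝ (LinearMap.range f) ≤ finrank ℝ E := by
  have h1 := LinearMap.finrank_range_add_finrank_ker f
  omega

lemma Kset_congr {U : Type} [AddCommGroup U] [Module ℝ U] [FiniteDimensional ℝ U] {h h' : V → U →ₗ[ℝ] ℝ} {S : Finset V} (hh : ∀ v ∈ S, h v = h' v)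
    (A1 A2 : Finset V) (H0 : Finset (Finset V))
    (x : Option (Option (Finset V)) → V → U) : Kset h S A1 A2 H0 x ↔ Kset h' S A1 A2 H0 x := by
  unfold Kset
  refine and_congr_left fun _ => forall_congr' fun i => ?_
  rw [mem_XX, mem_XX]
  refine and_congr_right fun _ => and_congr_right fun _ => forall₂_congr fun v hv => ?_
  rw [hh v hv]

theorem exists_gen {U Θ : Type} [NormedAddCommGroup U] [NormedSpace ℝ U] [FiniteDimensional ℝ U]
    [TopologicalSpace Θ] [Nonempty Θ] (hD : 2 ≤ finrank ℝ U) (Q : Θ → U →ₗ[ℝ] ℝ)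
    (hcont : ∀ y, Continuous fun t => Q t y) (hdense : ∀ y, y ≠ 0 → Dense {t | Q t y ≠ 0}) :
    ∃ θ : V → Θ, Gen (fun v => Q (θ v)) ∧ ∀ v, Q (θ v) ≠ 0 := by
  let Par : Type := Finset V × V × Finset V × Finset V × Finset (Finset V)
  let ρ : V ⊕ Par → (V → Θ) → ℕ := Sum.elim (fun v θ => finrank ℝ (LinearMap.range (Q (θ v))))
    (fun p θ => finrank ℝ (LinearMap.range (PhiMap (fun v => Q (θ v)) p.1 p.2.1 p.2.2.1 p.2.2.2.1 p.2.2.2.2)))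
  obtain ⟨θ, hθ⟩ := exists_locmax ρ (finrank ℝ U + finrank ℝ (Option (Option (Finset V)) → V → U)) (by
      rintro (v | p) θ
      · exact (rank_le_dom _).trans (Nat.le_add_right _ _)
      · exact (rank_le_dom _).trans (Nat.le_add_left _ _)) (by
      rintro (v | p) n
      · exact lsc_rank (fun θ : V → Θ => Q (θ v)) (fun y => (hcont y).comp (continuous_apply v)) n
      · refine lsc_rank (fun θ : V → Θ => PhiMap (fun v => Q (θ v)) p.1 p.2.1 p.2.2.1 p.2.2.2.1 p.2.2.2.2) ?_ n
        intro x
        have hc : ∀ (v : V) (y : U), Continuous fun θ : V → Θ => Q (θ v) y :=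
          fun v y => (hcont y).comp (continuous_apply v)
        refine Continuous.prodMk continuous_const (Continuous.prodMk continuous_const
          (Continuous.prodMk ?_ (Continuous.prodMk continuous_const (hc _ _))))
        refine continuous_pi fun i => continuous_pi fun v => ?_
        split_ifs
        · exact hc _ _
        · exact continuous_const)
  have hpert : ∀ (w : V) (y : U), y ≠ 0 → ∀ i, ∃ t, Q t y ≠ 0 ∧ ρ i (Function.update θ w t) ≤ ρ i θ := by
    intro w y hy i
    have hc : Filter.Tendsto (fun t => Function.update θ w t) (𝓝 (θ w)) (𝓝 θ) := by
      have : Continuous fun t => Function.update θ w t := continuous_const.update w continuous_id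
      have h2 := this.tendsto (θ w)
      rwa [Function.update_eq_self] at h2
    have h1 := hc.eventually (hθ i)
    obtain ⟨t, ht1, ht2⟩ := (hdense y hy).inter_nhds_nonempty h1
    exact ⟨t, ht1, ht2⟩
  have hgen : ∀ (S : Finset V) (w : V), w ∉ S → ∀ (A1 A2 : Finset V) (H0 : Finset (Finset V)),
    (∃ x1 ∈ XX (fun v => Q (θ v)) S A1, ∃ x2 ∈ XX (fun v => Q (θ v)) S A2, x1 + x2 ∈ TT (fun v => Q (θ v)) S H0 ∧ x1 w ≠ 0) →
    (∃ x1 ∈ XX (fun v => Q (θ v)) S A1, ∃ x2 ∈ XX (fun v => Q (θ v)) S A2, x1 + x2 ∈ TT (fun v => Q (θ v)) S H0 ∧ Q (θ w) (x1 w) ≠ 0) := by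
    intro S w hw A1 A2 H0 hex
    by_contra hno
    push Not at hno
    obtain ⟨x1, hx1, x2, hx2, hx12, hxw⟩ := hex
    obtain ⟨x, hx, hxn⟩ := (Kset_iff (fun v => Q (θ v)) S A1 A2 H0 x1).2 ⟨hx1, x2, hx2, hx12⟩
    have hall : ∀ z, Kset (fun v => Q (θ v)) S A1 A2 H0 z → Q (θ w) (z none w) = 0 := by
      intro z hz
      obtain ⟨p1, z2, p2, p3⟩ := (Kset_iff (fun v => Q (θ v)) S A1 A2 H0 (z none)).1 ⟨z, hz, rfl⟩
      exact hno _ p1 _ p2 p3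
    obtain ⟨t, ht, htle⟩ := hpert w (x1 w) hxw (Sum.inr (S, w, A1, A2, H0))
    have hSeq : ∀ v ∈ S, Q (Function.update θ w t v) = Q (θ v) := by
      intro v hv
      have e : v ≠ w := fun e => hw (e ▸ hv)
      rw [Function.update_of_ne e]
    have hlt : LinearMap.ker (PhiMap (fun v => Q (Function.update θ w t v)) S w A1 A2 H0) <
        LinearMap.ker (PhiMap (fun v => Q (θ v)) S w A1 A2 H0) := by
      refine lt_of_le_of_ne ?_ ?_
      · intro z hz
        rw [mem_ker_Phi] at hz ⊢
        have := (Kset_congr hSeq A1 A2 H0 z).1 hz.1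
        exact ⟨this, hall z this⟩
      · intro e
        have : x ∈ LinearMap.ker (PhiMap (fun v => Q (θ v)) S w A1 A2 H0) := (mem_ker_Phi _ _ _ _ _ _ _).2 ⟨hx, hall x hx⟩
        rw [← e, mem_ker_Phi] at this
        have h2 := this.2
        simp only [Function.update_self, hxn] at h2
        exact ht h2
    exact absurd htle (not_le.2 (rank_lt _ _ hlt))
  refine ⟨θ, ⟨?_, hgen⟩, ?_⟩
  · intro u w huw
    have hker : ∃ y, Q (θ u) y = 0 ∧ y ≠ 0 := by
      by_contra hcon
      push Not at hcon
      have hinj : LinearMap.ker (Q (θ u)) = ⊥ := by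
        rw [eq_bot_iff]; intro y hy; exact hcon y hy
      have := LinearMap.finrank_le_finrank_of_injective (LinearMap.ker_eq_bot.1 hinj)
      rw [finrank_self] at this
      omega
    obtain ⟨y, hy, hy0⟩ := hker
    have hm : (Pi.single w y - Pi.single u y : V → U) ∈ XX (fun v => Q (θ v)) {u} {u, w} := by
      refine ⟨fun v hv => ?_, ?_, fun v hv => ?_⟩
      · simp only [Finset.mem_insert, Finset.mem_singleton, not_or] at hv
        simp [hv.1, hv.2]
      · simp
      · rw [Finset.mem_singleton] at hv
        subst hv
        simp [huw, hy]
    obtain ⟨x1, hx1, _, _, _, hx⟩ := hgen {u} w (by simpa using huw.symm) {u, w} {u, w} ∅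
      ⟨_, hm, _, neg_mem hm, by rw [add_neg_cancel]; exact zero_mem _, by simp [huw.symm, hy0]⟩
    refine ⟨x1 w, ?_, hx⟩
    have h0 : x1 w = - x1 u := by
      have h1 := hx1.2.1
      rw [← Finset.sum_subset (Finset.subset_univ {u, w}) (fun v _ hv => hx1.1 v hv), Finset.sum_pair huw] at h1
      exact eq_neg_of_add_eq_zero_right h1
    rw [h0, map_neg, hx1.2.2 u (by simp), neg_zero]
  · intro v hv
    have : Nontrivial U := Module.nontrivial_of_finrank_pos (R := ℝ) (by omega)
    obtain ⟨y, hy⟩ := exists_ne (0 : U)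
    obtain ⟨t, ht, htle⟩ := hpert v y hy (Sum.inl v)
    change finrank ℝ (LinearMap.range (Q (Function.update θ v t v))) ≤ finrank ℝ (LinearMap.range (Q (θ v))) at htle
    rw [Function.update_self, hv, LinearMap.range_zero, finrank_bot] at htle
    have h0 : LinearMap.range (Q t) = ⊥ := Submodule.finrank_eq_zero.1 (by omega)
    rw [LinearMap.range_eq_bot] at h0
    exact ht (by rw [h0]; rfl)
end

section ext
open Module

noncomputable def lamv (m : ℕ) : ExtAlg (m + 1) →ₗ[ℝ] ℝ :=
  liftAlternating (R := ℝ) (Function.update (fun i => (0 : Wd (m + 1) [⋀^Fin i]→ₗ[ℝ] ℝ)) (m + 2)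
    (Matrix.detRowAlternating (n := Fin (m + 2)) (R := ℝ)))

lemma lamv_apply (m : ℕ) (v : Fin (m + 2) → Wd (m + 1)) :
    lamv m (ιMulti ℝ (m + 2) v) = Matrix.det (Matrix.of v) := by
  unfold lamv
  rw [liftAlternating_apply_ιMulti, Function.update_self]
  rfl

lemma lamv_inj (m : ℕ) {z : ExtAlg (m + 1)} (hz : z ∈ extGrade (m + 1) (m + 2)) (h0 : lamv m z = 0) : z = 0 := by
  have key : ∀ z ∈ extGrade (m + 1) (m + 2),
      z = lamv m z • ιMulti ℝ (m + 2) (fun i => (Pi.basisFun ℝ (Fin (m + 2))) i) := by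
    intro z hz
    have hz' : z ∈ Submodule.span ℝ (Set.range (ιMulti ℝ (m + 2) (M := Wd (m + 1)))) := by
      rw [ιMulti_span_fixedDegree]; exact hz
    induction hz' using Submodule.span_induction with
    | mem x hx =>
      obtain ⟨v, rfl⟩ := hx
      have : (ιMulti ℝ (m + 2) : Wd (m + 1) [⋀^Fin (m + 2)]→ₗ[ℝ] _) =
          (LinearMap.toSpanSingleton ℝ _ (ιMulti ℝ (m + 2) (fun i => (Pi.basisFun ℝ (Fin (m + 2))) i))).compAlternatingMap
            (Matrix.detRowAlternating (n := Fin (m + 2)) (R := ℝ)) := by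
        refine Basis.ext_alternating (Pi.basisFun ℝ (Fin (m + 2))) fun i hi => ?_
        let σ : Equiv.Perm (Fin (m + 2)) := Equiv.ofBijective i (Finite.injective_iff_bijective.1 hi)
        have e1 : (fun j => (Pi.basisFun ℝ (Fin (m + 2))) (i j)) = (fun j => (Pi.basisFun ℝ (Fin (m + 2))) j) ∘ σ := rfl
        rw [e1, AlternatingMap.map_perm, AlternatingMap.map_perm]
        congr 1
        simp only [LinearMap.compAlternatingMap_apply, LinearMap.toSpanSingleton_apply]
        have : Matrix.detRowAlternating (fun j => (Pi.basisFun ℝ (Fin (m + 2))) j) = (1 : ℝ) := by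
          rw [← Matrix.det_one (n := Fin (m + 2)) (R := ℝ)]
          change Matrix.det _ = Matrix.det _
          congr 1
          ext a b
          simp [Matrix.one_apply, Pi.single_apply, eq_comm]
        rw [this, one_smul]
      rw [lamv_apply]
      exact congrArg (fun f => f v) this
    | zero => simp
    | add x y hx hy ihx ihy =>
      have hx' := ihx (by rw [ιMulti_span_fixedDegree] at hx; exact hx)
      have hy' := ihy (by rw [ιMulti_span_fixedDegree] at hy; exact hy)
      rw [map_add, add_smul, ← hx', ← hy']
    | smul c x hx ihx =>
      have hx' := ihx (by rw [ιMulti_span_fixedDegree] at hx; exact hx)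
      rw [map_smul, smul_assoc, ← hx']
  rw [key z hz, h0, zero_smul]

lemma wedge_zero_iff (m : ℕ) {y : ExtAlg (m + 1)} (hy : y ∈ extGrade (m + 1) 2) (t : Fin m → Wd (m + 1)) :
    y * ιMulti ℝ m t = 0 ↔ lamv m (y * ιMulti ℝ m t) = 0 := by
  refine ⟨fun h => by rw [h, map_zero], fun h => lamv_inj m ?_ h⟩
  have e : ∀ k, k = 2 + m → y * ιMulti ℝ m t ∈ extGrade (m + 1) k := ?_
  · exact e _ (Nat.add_comm _ _)
  rintro k rfl
  unfold extGrade at *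
  rw [pow_add]
  refine Submodule.mul_mem_mul hy ?_
  have : ιMulti ℝ m t ∈ Submodule.span ℝ (Set.range (ιMulti ℝ m (M := Wd (m + 1)))) := Submodule.subset_span ⟨t, rfl⟩
  rw [ιMulti_span_fixedDegree] at this
  exact this

lemma grade2_expand (m : ℕ) {y : ExtAlg (m + 1)} (hy : y ∈ extGrade (m + 1) 2) :
    ∃ c : Fin (m + 2) × Fin (m + 2) → ℝ, y = ∑ p, c p • (ι ℝ (Pi.single p.1 1 : Wd (m + 1)) * ι ℝ (Pi.single p.2 1)) := by
  unfold extGrade at hy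
  rw [pow_two] at hy
  induction hy using Submodule.mul_induction_on' with
  | mem_mul_mem a ha b hb =>
    obtain ⟨a, rfl⟩ := ha
    obtain ⟨b, rfl⟩ := hb
    refine ⟨fun p => a p.1 * b p.2, ?_⟩
    have ea : a = ∑ i, a i • (Pi.single i 1 : Wd (m + 1)) := (pi_eq_sum_univ' a).trans (by
      refine Finset.sum_congr rfl fun i _ => ?_
      congr 1)
    have eb : b = ∑ i, b i • (Pi.single i 1 : Wd (m + 1)) := (pi_eq_sum_univ' b).trans (by
      refine Finset.sum_congr rfl fun i _ => ?_
      congr 1)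
    conv_lhs => rw [ea, eb]
    rw [map_sum, map_sum, Finset.sum_mul_sum, Fintype.sum_prod_type]
    refine Finset.sum_congr rfl fun i _ => Finset.sum_congr rfl fun j _ => ?_
    rw [map_smul, map_smul, smul_mul_smul_comm]
  | add x hx y hy ihx ihy =>
    obtain ⟨c, hc⟩ := ihx
    obtain ⟨c', hc'⟩ := ihy
    refine ⟨c + c', ?_⟩
    rw [hc, hc', ← Finset.sum_add_distrib]
    simp [add_smul]

lemma ee_mul (m : ℕ) (a b : Wd (m + 1)) (t : Fin m → Wd (m + 1)) :
    ι ℝ a * ι ℝ b * ιMulti ℝ m t = ιMulti ℝ (m + 2) (Matrix.vecCons a (Matrix.vecCons b t)) := by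
  rw [ιMulti_succ_apply, Matrix.tail_cons, ιMulti_succ_apply, Matrix.tail_cons, mul_assoc]
  simp

lemma wedge_nondeg (m : ℕ) {y : ExtAlg (m + 1)} (hy : y ∈ extGrade (m + 1) 2)
    (h : ∀ t : Fin m → Wd (m + 1), lamv m (y * ιMulti ℝ m t) = 0) : y = 0 := by
  obtain ⟨c, hc⟩ := grade2_expand m hy
  set e : Fin (m + 2) → Wd (m + 1) := fun i => Pi.single i 1 with he
  have hanti : ∀ i j, ι ℝ (e j) * ι ℝ (e i) = - (ι ℝ (e i) * ι ℝ (e j)) := fun i j =>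
    eq_neg_of_add_eq_zero_left (ι_add_mul_swap _ _)
  have hsymm : ∀ i j, c (i, j) = c (j, i) := by
    intro i j
    by_cases hij : i = j
    · rw [hij]
    have hcard : (({i, j} : Finset (Fin (m + 2)))ᶜ).card = m := by
      rw [Finset.card_compl, Finset.card_pair hij]; simp
    let τ : Fin m → Fin (m + 2) := ({i, j} : Finset (Fin (m + 2)))ᶜ.orderEmbOfFin hcard
    have hτinj : Function.Injective τ := (({i, j} : Finset (Fin (m + 2)))ᶜ.orderEmbOfFin hcard).injective
    have hτr : ∀ k, k ≠ i → k ≠ j → ∃ a, τ a = k := by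
      intro k h1 h2
      have : k ∈ Set.range τ := by
        rw [Finset.range_orderEmbOfFin]; simp [h1, h2]
      exact this
    have hτn : ∀ a, τ a ≠ i ∧ τ a ≠ j := by
      intro a
      have : τ a ∈ ({i, j} : Finset (Fin (m + 2)))ᶜ := Finset.orderEmbOfFin_mem _ hcard a
      rw [Finset.mem_compl, Finset.mem_insert, Finset.mem_singleton, not_or] at this
      exact this
    have hzero : ∀ k l, lamv m (ι ℝ (e k) * ι ℝ (e l) * ιMulti ℝ m (e ∘ τ)) ≠ 0 → k ≠ l ∧ (k = i ∨ k = j) ∧ (l = i ∨ l = j) := by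
      intro k l hkl
      refine ⟨?_, ?_, ?_⟩
      · rintro rfl
        rw [ι_sq_zero, zero_mul, map_zero] at hkl
        exact hkl rfl
      · by_contra hcon
        push Not at hcon
        obtain ⟨a, ha⟩ := hτr k hcon.1 hcon.2
        apply hkl
        have := ι_mul_prod_list (R := ℝ) (e ∘ τ) a
        rw [← ιMulti_apply, Function.comp_apply, ha] at this
        rw [hanti, neg_mul, mul_assoc, this, mul_zero, neg_zero, map_zero]
      · by_contra hcon
        push Not at hcon
        obtain ⟨a, ha⟩ := hτr l hcon.1 hcon.2
        apply hkl
        have := ι_mul_prod_list (R := ℝ) (e ∘ τ) a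
        rw [← ιMulti_apply, Function.comp_apply, ha] at this
        rw [mul_assoc, this, mul_zero, map_zero]
    have hne : lamv m (ι ℝ (e i) * ι ℝ (e j) * ιMulti ℝ m (e ∘ τ)) ≠ 0 := by
      rw [ee_mul]
      have e1 : Matrix.vecCons (e i) (Matrix.vecCons (e j) (e ∘ τ)) = e ∘ Matrix.vecCons i (Matrix.vecCons j τ) := by
        funext a
        refine Fin.cases ?_ (fun a => Fin.cases ?_ (fun a => ?_) a) a <;> simp
      have hinj : Function.Injective (Matrix.vecCons i (Matrix.vecCons j τ)) := by
        refine Fin.cons_injective_iff.2 ⟨?_, Fin.cons_injective_iff.2 ⟨?_, hτinj⟩⟩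
        · rintro ⟨a, ha⟩
          revert ha
          refine Fin.cases ?_ (fun a => ?_) a
          · intro ha; exact hij (by simpa using ha.symm)
          · intro ha; exact (hτn a).1 (by simpa using ha)
        · rintro ⟨a, ha⟩
          exact (hτn a).2 ha
      let σ : Equiv.Perm (Fin (m + 2)) := Equiv.ofBijective _ (Finite.injective_iff_bijective.1 hinj)
      rw [e1, show e ∘ Matrix.vecCons i (Matrix.vecCons j τ) = e ∘ σ from rfl, AlternatingMap.map_perm]
      have hdet : lamv m (ιMulti ℝ (m + 2) e) = 1 := by
        rw [lamv_apply, ← Matrix.det_one (n := Fin (m + 2)) (R := ℝ)]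
        congr 1
        ext a b
        simp [he, Matrix.one_apply, Pi.single_apply, eq_comm]
      rcases Int.units_eq_one_or (Equiv.Perm.sign σ) with hs | hs
      · rw [hs, one_smul, hdet]; norm_num
      · rw [hs, Units.neg_smul, one_smul, map_neg, hdet]; norm_num
    have h0 := h (e ∘ τ)
    rw [hc, Finset.sum_mul, map_sum, Finset.sum_eq_add (i, j) (j, i) (by simp [hij]) (by
      rintro ⟨k, l⟩ _ ⟨hn1, hn2⟩
      by_contra hcon
      have hz : lamv m (ι ℝ (e k) * ι ℝ (e l) * ιMulti ℝ m (e ∘ τ)) ≠ 0 := by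
        intro hz
        apply hcon
        rw [smul_mul_assoc, map_smul]
        change _ • lamv m (ι ℝ (e k) * ι ℝ (e l) * ιMulti ℝ m (e ∘ τ)) = 0
        rw [hz, smul_zero]
      obtain ⟨z1, z2, z3⟩ := hzero k l hz
      rcases z2 with z2 | z2 <;> rcases z3 with z3 | z3
      · exact z1 (z2.trans z3.symm)
      · exact hn1 (by rw [z2, z3])
      · exact hn2 (by rw [z2, z3])
      · exact z1 (z2.trans z3.symm)) (by simp) (by simp)] at h0
    change lamv m ((c (i, j) • (ι ℝ (e i) * ι ℝ (e j))) * _) + lamv m ((c (j, i) • (ι ℝ (e j) * ι ℝ (e i))) * _) = 0 at h0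
    rw [hanti i j, smul_mul_assoc, smul_mul_assoc, neg_mul, map_smul, map_smul, map_neg, smul_eq_mul, smul_eq_mul] at h0
    have : (c (i, j) - c (j, i)) * lamv m (ι ℝ (e i) * ι ℝ (e j) * ιMulti ℝ m (e ∘ τ)) = 0 := by linarith
    rcases mul_eq_zero.1 this with h1 | h1
    · linarith
    · exact absurd h1 hne
  have h2 : y = - y := by
    conv_lhs => rw [hc]
    rw [← Equiv.sum_comp (Equiv.prodComm _ _)]
    conv_rhs => rw [hc]
    rw [← Finset.sum_neg_distrib]
    refine Finset.sum_congr rfl ?_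
    rintro ⟨i, j⟩ _
    change c (j, i) • (ι ℝ (e j) * ι ℝ (e i)) = - (c (i, j) • (ι ℝ (e i) * ι ℝ (e j)))
    rw [hanti i j, hsymm i j, smul_neg]
  have h3 : (2 : ℝ) • y = 0 := by
    rw [two_smul]; nth_rewrite 2 [h2]; exact add_neg_cancel y
  exact (smul_eq_zero.1 h3).resolve_left (by norm_num)

lemma wedge_cont (m : ℕ) {y : ExtAlg (m + 1)} (hy : y ∈ extGrade (m + 1) 2) :
    Continuous fun t : Fin m → Wd (m + 1) => lamv m (y * ιMulti ℝ m t) := by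
  obtain ⟨c, hc⟩ := grade2_expand m hy
  have : (fun t : Fin m → Wd (m + 1) => lamv m (y * ιMulti ℝ m t)) = fun t => ∑ p, c p *
      Matrix.det (Matrix.of (Matrix.vecCons (Pi.single p.1 1 : Wd (m + 1)) (Matrix.vecCons (Pi.single p.2 1 : Wd (m + 1)) t))) := by
    funext t
    rw [hc, Finset.sum_mul, map_sum]
    refine Finset.sum_congr rfl fun p _ => ?_
    rw [smul_mul_assoc, ee_mul, map_smul, lamv_apply, smul_eq_mul]
  rw [this]
  refine continuous_finsetSum _ fun p _ => continuous_const.mul (Continuous.matrix_det ?_)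
  refine continuous_pi fun a => ?_
  refine Fin.cases ?_ (fun a => Fin.cases ?_ (fun a => ?_) a) a
  · exact continuous_const
  · exact continuous_const
  · exact continuous_apply a

lemma wedge_dense (m : ℕ) {y : ExtAlg (m + 1)} (hy : y ∈ extGrade (m + 1) 2) (hy0 : y ≠ 0) :
    Dense {t : Fin m → Wd (m + 1) | lamv m (y * ιMulti ℝ m t) ≠ 0} := by
  by_contra hnd
  apply hy0
  apply wedge_nondeg m hy
  let f : ContinuousMultilinearMap ℝ (fun _ : Fin m => Wd (m + 1)) ℝ :=
    { (lamv m ∘ₗ LinearMap.mulLeft ℝ y).compMultilinearMap (ιMulti ℝ m : Wd (m + 1) [⋀^Fin m]→ₗ[ℝ] _).toMultilinearMap with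
      cont := wedge_cont m hy }
  have hf : ∀ t, f t = lamv m (y * ιMulti ℝ m t) := fun t => rfl
  unfold Dense at hnd
  push Not at hnd
  obtain ⟨t0, ht0⟩ := hnd
  have hev : f =ᶠ[nhds t0] 0 := by
    filter_upwards [isClosed_closure.isOpen_compl.mem_nhds ht0] with t ht
    by_contra hne
    exact ht (subset_closure hne)
  have han : AnalyticOnNhd ℝ f Set.univ := f.analyticOnNhd
  have := han.eqOn_zero_of_preconnected_of_eventuallyEq_zero isPreconnected_univ (Set.mem_univ t0) hev
  intro t
  exact this (Set.mem_univ t)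
end ext

section asm
open Module

def edgeH {V E : Type} [DecidableEq V] (ends : E → V × V) (F : Finset E) : Finset (Finset V) :=
  F.image (fun e => ({(ends e).1, (ends e).2} : Finset V))

lemma VF_two {V E : Type} [DecidableEq V] {ends : E → V × V} (hloop : ∀ e : E, (ends e).1 ≠ (ends e).2)
    {p : Finset E} (hp : p.Nonempty) : 2 ≤ (VF ends p).card := by
  obtain ⟨e, he⟩ := hp
  rw [← Finset.card_pair (hloop e)]
  refine Finset.card_le_card ?_
  intro x hx
  rw [Finset.mem_insert, Finset.mem_singleton] at hx
  unfold VF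
  rw [Finset.mem_union, Finset.mem_image, Finset.mem_image]
  rcases hx with rfl | rfl
  · exact Or.inl ⟨e, he, rfl⟩
  · exact Or.inr ⟨e, he, rfl⟩

lemma part_val {V E : Type} [Fintype V] [DecidableEq V] [DecidableEq E] {ends : E → V × V} (hloop : ∀ e : E, (ends e).1 ≠ (ends e).2)
    (D : ℕ) (R : Finset V) {F : Finset E} {P : Finset (Finset E)} (hP : IsPartitionOf F P) :
    ∑ p ∈ P, ((D : ℤ) * (VF ends p).card - D - ((VF ends p) ∩ R).card) = ∑ p ∈ P, fp D R (VF ends p) :=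
  Finset.sum_congr rfl fun p hp => (fp_of (VF_two hloop (hP.1 p hp))).symm

lemma comb_least {V E U : Type} [Fintype V] [DecidableEq V] [DecidableEq E] [AddCommGroup U] [Module ℝ U]
    [FiniteDimensional ℝ U] (ends : E → V × V) (hloop : ∀ e : E, (ends e).1 ≠ (ends e).2)
    {h : V → U →ₗ[ℝ] ℝ} (hg : Gen h) (hD : 4 ≤ finrank ℝ U) (R : Finset V) (F : Finset E) :
    IsLeast {s : ℤ | ∃ P : Finset (Finset E), IsPartitionOf F P ∧
            s = ∑ p ∈ P, (((finrank ℝ U : ℕ) : ℤ) * (VF ends p).card - (finrank ℝ U : ℕ) - ((VF ends p) ∩ R).card)}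
          (finrank ℝ (TT h R (edgeH ends F)) : ℤ) := by
  have hD2 : 2 ≤ finrank ℝ U := by omega
  have upper : ∀ P : Finset (Finset E), IsPartitionOf F P →
      (finrank ℝ (TT h R (edgeH ends F)) : ℤ) ≤ ∑ p ∈ P, fp (finrank ℝ U) R (VF ends p) := by
    intro P hP
    have hc : Cov (edgeH ends F) (P.image (VF ends)) := by
      intro A hA
      obtain ⟨e, he, rfl⟩ := Finset.mem_image.1 hA
      rw [← hP.2.2, Finset.mem_biUnion] at he
      obtain ⟨p, hp, hep⟩ := he
      refine ⟨VF ends p, Finset.mem_image_of_mem _ hp, ?_⟩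
      intro x hx
      rw [Finset.mem_insert, Finset.mem_singleton] at hx
      unfold VF
      rw [Finset.mem_union, Finset.mem_image, Finset.mem_image]
      rcases hx with rfl | rfl
      · exact Or.inl ⟨e, hep, rfl⟩
      · exact Or.inr ⟨e, hep, rfl⟩
    have h1 : finrank ℝ (TT h R (edgeH ends F)) ≤ finrank ℝ (TT h R (P.image (VF ends))) :=
      Submodule.finrank_mono (TT_cov h R hc)
    have h2 := finrank_TT_le hg R (P.image (VF ends))
    have h3 : ∀ P : Finset (Finset E), cc (finrank ℝ U) R (P.image (VF ends)) ≤ ∑ p ∈ P, fp (finrank ℝ U) R (VF ends p) := by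
      intro P
      induction P using Finset.induction_on with
      | empty => simp [cc]
      | insert a P ha ih =>
        rw [Finset.image_insert, Finset.sum_insert ha]
        exact (cc_insert_le hD2 R _ _).trans (by linarith)
    have := h3 P
    have h1' : (finrank ℝ (TT h R (edgeH ends F)) : ℤ) ≤ finrank ℝ (TT h R (P.image (VF ends))) := by exact_mod_cast h1
    linarith
  constructor
  · obtain ⟨Q, hQ, hle⟩ := main_cover hg hD (edgeH ends F).card _ (edgeH ends F) R le_rfl (Nat.lt_succ_self _)
    have : ∀ e, ∃ B, e ∈ F → B ∈ Q ∧ ({(ends e).1, (ends e).2} : Finset V) ⊆ B := by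
      intro e
      by_cases he : e ∈ F
      · obtain ⟨B, hB, hs⟩ := hQ _ (Finset.mem_image_of_mem (fun e => ({(ends e).1, (ends e).2} : Finset V)) he)
        exact ⟨B, fun _ => ⟨hB, hs⟩⟩
      · exact ⟨∅, fun h => absurd h he⟩
    choose b hb using this
    set fib : Finset V → Finset E := fun B => F.filter (fun e => b e = B) with hfib
    set P : Finset (Finset E) := (F.image b).image fib with hPdef
    have hinj : Set.InjOn fib (F.image b) := by
      intro B hB B' _ heq
      obtain ⟨e, he, rfl⟩ := Finset.mem_image.1 (Finset.mem_coe.1 hB)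
      have : e ∈ fib (b e) := Finset.mem_filter.2 ⟨he, rfl⟩
      rw [heq] at this
      exact (Finset.mem_filter.1 this).2
    have hP : IsPartitionOf F P := by
      refine ⟨?_, ?_, ?_⟩
      · intro p hp
        obtain ⟨B, hB, rfl⟩ := Finset.mem_image.1 hp
        obtain ⟨e, he, rfl⟩ := Finset.mem_image.1 hB
        exact ⟨e, Finset.mem_filter.2 ⟨he, rfl⟩⟩
      · intro p hp q hq hpq
        obtain ⟨B, hB, rfl⟩ := Finset.mem_image.1 (Finset.mem_coe.1 hp)
        obtain ⟨B', hB', rfl⟩ := Finset.mem_image.1 (Finset.mem_coe.1 hq)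
        change Disjoint (fib B) (fib B')
        rw [Finset.disjoint_left]
        intro e h1 h2
        apply hpq
        rw [← (Finset.mem_filter.1 h1).2, ← (Finset.mem_filter.1 h2).2]
      · ext e
        rw [Finset.mem_biUnion]
        constructor
        · rintro ⟨p, hp, hep⟩
          obtain ⟨B, hB, rfl⟩ := Finset.mem_image.1 hp
          exact (Finset.mem_filter.1 hep).1
        · intro he
          exact ⟨fib (b e), Finset.mem_image_of_mem _ (Finset.mem_image_of_mem _ he), Finset.mem_filter.2 ⟨he, rfl⟩⟩
    refine ⟨P, hP, ?_⟩
    rw [part_val hloop _ R hP]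
    refine le_antisymm (upper P hP) (le_trans ?_ hle)
    rw [hPdef, Finset.sum_image hinj]
    have h1 : ∑ B ∈ F.image b, fp (finrank ℝ U) R (VF ends (fib B)) ≤ ∑ B ∈ F.image b, fp (finrank ℝ U) R B := by
      refine Finset.sum_le_sum fun B _ => fp_mono hD2 ?_
      intro x hx
      unfold VF at hx
      rw [Finset.mem_union, Finset.mem_image, Finset.mem_image] at hx
      rcases hx with ⟨e, he, rfl⟩ | ⟨e, he, rfl⟩
      · obtain ⟨he1, rfl⟩ := Finset.mem_filter.1 he
        exact (hb e he1).2 (by simp)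
      · obtain ⟨he1, rfl⟩ := Finset.mem_filter.1 he
        exact (hb e he1).2 (by simp)
    refine h1.trans ?_
    unfold cc
    refine Finset.sum_le_sum_of_subset_of_nonneg ?_ fun B _ _ => fp_nonneg hD2 R B
    intro B hB
    obtain ⟨e, he, rfl⟩ := Finset.mem_image.1 hB
    exact (hb e he).1
  · rintro s ⟨P, hP, rfl⟩
    rw [part_val hloop _ R hP]
    exact upper P hP

lemma rod_image {V E U : Type} [Fintype V] [DecidableEq V] [AddCommGroup U] [Module ℝ U]
    (m : ℕ) (ends : E → V × V) (hloop : ∀ e : E, (ends e).1 ≠ (ends e).2) (R : Finset V)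
    (g : U →ₗ[ℝ] ExtAlg (m + 1)) (hgr : LinearMap.range g = extGrade (m + 1) 2)
    (r : V → ExtAlg (m + 1)) (h : V → U →ₗ[ℝ] ℝ) (hh : ∀ v y, h v y = 0 ↔ g y * r v = 0) (e : E) :
    rodFlat (m + 1) ends r R e = (XX h R {(ends e).1, (ends e).2}).map (g.compLeft V) := by
  have hl := hloop e
  set u := (ends e).1 with hu
  set v := (ends e).2 with hv
  ext z
  unfold rodFlat barSpace
  rw [← hu, ← hv, Submodule.mem_map, Submodule.mem_map]
  constructor
  · rintro ⟨a, ha, rfl⟩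
    rw [Submodule.mem_inf, ← hgr] at ha
    obtain ⟨⟨y, rfl⟩, ha⟩ := ha
    refine ⟨Pi.single u y - Pi.single v y, ⟨?_, ?_, ?_⟩, ?_⟩
    · intro w hw
      rw [Finset.mem_insert, Finset.mem_singleton, not_or] at hw
      rw [Pi.sub_apply, Pi.single_eq_of_ne hw.1, Pi.single_eq_of_ne hw.2, sub_zero]
    · simp [Finset.sum_sub_distrib]
    · intro w hw
      simp only [Submodule.mem_iInf] at ha
      have key : w = u ∨ w = v → h w y = 0 := by
        intro hwuv
        rw [hh]
        have := ha w (Finset.mem_inter.2 ⟨by rw [Finset.mem_insert, Finset.mem_singleton]; exact hwuv, hw⟩)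
        simpa using this
      by_cases h1 : w = u
      · subst h1
        rw [Pi.sub_apply, Pi.single_eq_same, Pi.single_eq_of_ne hl, sub_zero]
        exact key (Or.inl rfl)
      by_cases h2 : w = v
      · subst h2
        rw [Pi.sub_apply, Pi.single_eq_same, Pi.single_eq_of_ne h1, zero_sub, map_neg, key (Or.inr rfl), neg_zero]
      · rw [Pi.sub_apply, Pi.single_eq_of_ne h1, Pi.single_eq_of_ne h2, sub_zero, map_zero]
    · funext w
      change g ((Pi.single u y - Pi.single v y : V → U) w) = (Pi.single u (g y) - Pi.single v (g y) : V → ExtAlg (m + 1)) w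
      rw [Pi.sub_apply, Pi.sub_apply, map_sub]
      congr 1
      · by_cases h1 : w = u
        · subst h1; rw [Pi.single_eq_same, Pi.single_eq_same]
        · rw [Pi.single_eq_of_ne h1, Pi.single_eq_of_ne h1, map_zero]
      · by_cases h1 : w = v
        · rw [h1, Pi.single_eq_same, Pi.single_eq_same]
        · rw [Pi.single_eq_of_ne h1, Pi.single_eq_of_ne h1, map_zero]
  · rintro ⟨x, ⟨x1, x2, x3⟩, rfl⟩
    have hxv : x v = - x u := by
      have : ∑ w, x w = x u + x v := by
        rw [← Finset.sum_pair hl]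
        symm
        exact Finset.sum_subset (Finset.subset_univ _) fun w _ hw => x1 w hw
      rw [x2] at this
      exact eq_neg_of_add_eq_zero_right this.symm
    refine ⟨g (x u), ?_, ?_⟩
    · rw [Submodule.mem_inf, ← hgr]
      refine ⟨⟨x u, rfl⟩, ?_⟩
      simp only [Submodule.mem_iInf]
      intro w hw
      rw [Finset.mem_inter, Finset.mem_insert, Finset.mem_singleton] at hw
      rw [LinearMap.mem_ker, LinearMap.mulRight_apply, ← hh]
      have := x3 w hw.2
      rcases hw.1 with h1 | h1
      · rw [h1] at this ⊢; exact this
      · rw [h1, hxv, map_neg, neg_eq_zero] at this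
        rw [h1]; exact this
    · funext w
      change (Pi.single u (g (x u)) - Pi.single v (g (x u)) : V → ExtAlg (m + 1)) w = g (x w)
      rw [Pi.sub_apply]
      by_cases h1 : w = u
      · rw [h1, Pi.single_eq_same, Pi.single_eq_of_ne hl, sub_zero]
      by_cases h2 : w = v
      · rw [h2, Pi.single_eq_same, Pi.single_eq_of_ne hl.symm, zero_sub, hxv, map_neg]
      · rw [Pi.single_eq_of_ne h1, Pi.single_eq_of_ne h2, sub_zero, x1 w (by simp [h1, h2]), map_zero]

lemma rod_finrank {V E U : Type} [Fintype V] [DecidableEq V] [AddCommGroup U] [Module ℝ U]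
    (m : ℕ) (ends : E → V × V) (hloop : ∀ e : E, (ends e).1 ≠ (ends e).2) (R : Finset V)
    (g : U →ₗ[ℝ] ExtAlg (m + 1)) (hinj : Function.Injective g) (hgr : LinearMap.range g = extGrade (m + 1) 2)
    (r : V → ExtAlg (m + 1)) (h : V → U →ₗ[ℝ] ℝ) (hh : ∀ v y, h v y = 0 ↔ g y * r v = 0) (F : Finset E) :
    finrank ℝ ↥(⨆ e ∈ F, rodFlat (m + 1) ends r R e) = finrank ℝ (TT h R (edgeH ends F)) := by
  have h1 : (⨆ e ∈ F, rodFlat (m + 1) ends r R e) = (TT h R (edgeH ends F)).map (g.compLeft V) := by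
    unfold TT edgeH
    rw [Finset.iSup_finset_image]
    simp only [Submodule.map_iSup]
    refine iSup_congr fun e => iSup_congr fun _ => rod_image m ends hloop R g hgr r h hh e
  have hinj' : Function.Injective (g.compLeft V) := fun a b hab => funext fun v => hinj (congrFun hab v)
  rw [h1]
  exact (LinearEquiv.finrank_eq (Submodule.equivMapOfInjective _ hinj' _)).symm
end asm

theorem statement_1
    (d : ℕ) (hd : 3 ≤ d) (D : ℕ) (hD : D = (d + 1).choose 2)
    (V E : Type) [Fintype V] [Fintype E] [DecidableEq V] [DecidableEq E]
    (ends : E → V × V) (hloop : ∀ e : E, (ends e).1 ≠ (ends e).2)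
    (B R : Finset V) (hdisj : Disjoint B R) (hcov : B ∪ R = Finset.univ) :
    ∃ r : V → ExtAlg d,
      (∀ v ∈ R, r v ≠ 0) ∧
      (∀ v ∈ R, IsDecomp d (d - 1) (r v)) ∧
      (∀ u ∈ R, ∀ v ∈ R, u ≠ v → ∀ c : ℝ, r u ≠ c • r v) ∧
      (∀ F : Finset E, F.Nonempty →
        IsLeast
          {s : ℤ | ∃ P : Finset (Finset E), IsPartitionOf F P ∧
            s = ∑ p ∈ P, ((D : ℤ) * (VF ends p).card - D - ((VF ends p) ∩ R).card)}
          (Module.finrank ℝ ↥(⨆ e ∈ F, rodFlat d ends r R e) : ℤ)) := by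
  obtain ⟨m, rfl⟩ : ∃ m, d = m + 1 := ⟨d - 1, by omega⟩
  have hD4 : 4 ≤ D := by
    rw [hD]
    calc 4 ≤ Nat.choose 4 2 := by decide
      _ ≤ _ := Nat.choose_le_choose 2 (by omega)
  have hfin : Module.finrank ℝ (extGrade (m + 1) 2) = D := by
    have := exteriorPower.finrank_eq (R := ℝ) (M := Wd (m + 1)) 2
    rw [Module.finrank_fin_fun] at this
    rw [hD, ← this]
    rfl
  have : Module.Finite ℝ (extGrade (m + 1) 2) := Module.finite_of_finrank_pos (by omega)
  let U := Fin D → ℝ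
  have hU : Module.finrank ℝ U = D := Module.finrank_fin_fun ℝ
  let ee : U ≃ₗ[ℝ] extGrade (m + 1) 2 := LinearEquiv.ofFinrankEq _ _ (hU.trans hfin.symm)
  let g : U →ₗ[ℝ] ExtAlg (m + 1) := (extGrade (m + 1) 2).subtype ∘ₗ ee.toLinearMap
  have hginj : Function.Injective g := (Submodule.injective_subtype _).comp ee.injective
  have hgr : LinearMap.range g = extGrade (m + 1) 2 := by
    rw [LinearMap.range_comp, LinearEquiv.range, Submodule.map_top, Submodule.range_subtype]
  have hgm : ∀ y, g y ∈ extGrade (m + 1) 2 := fun y => (ee y).2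
  let Q : (Fin m → Wd (m + 1)) → U →ₗ[ℝ] ℝ := fun t =>
    lamv m ∘ₗ LinearMap.mulRight ℝ (ιMulti ℝ m t) ∘ₗ g
  have hQ : ∀ t y, Q t y = lamv m (g y * ιMulti ℝ m t) := fun t y => rfl
  obtain ⟨θ, hgen, hne⟩ := exists_gen (V := V) (U := U) (by omega) Q
    (fun y => wedge_cont m (hgm y))
    (fun y hy => wedge_dense m (hgm y) (fun h0 => hy (hginj (h0.trans (map_zero g).symm))))
  have hh : ∀ v y, Q (θ v) y = 0 ↔ g y * ιMulti ℝ m (θ v) = 0 := fun v y =>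
    (wedge_zero_iff m (hgm y) (θ v)).symm
  refine ⟨fun v => ιMulti ℝ m (θ v), ?_, ?_, ?_, ?_⟩
  · intro v _ h0
    apply hne v
    refine LinearMap.ext fun y => ?_
    change Q (θ v) _ = 0
    change ιMulti ℝ m (θ v) = 0 at h0
    rw [hh, h0, mul_zero]
  · intro v _
    exact ⟨θ v, ιMulti_apply _⟩
  · intro u _ v _ huv c hc
    obtain ⟨y, h1, h2⟩ := hgen.indep v u huv.symm
    apply h2
    rw [hh] at h1 ⊢
    change ιMulti ℝ m (θ u) = c • ιMulti ℝ m (θ v) at hc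
    rw [hc, mul_smul_comm, h1, smul_zero]
  · intro F _
    have hl := comb_least ends hloop hgen (by omega) R F
    rw [hU] at hl
    rw [rod_finrank m ends hloop R g hginj hgr (fun v => ιMulti ℝ m (θ v)) (fun v => Q (θ v)) hh F]
    exact hl
end

section
/- Let d≥3 be an integer, W=ℝ^{d+1}, D=binom(d+1,2). Let G=(V,E) be a finite multigraph with |V|≥2 and {B,R} a partition of V. Then for every rod-configuration r on R (each r_v∈⋀^{d−1}W nonzero decomposable, and r_u, r_v not scalar multiples of each other for distinct u,v∈R), the dimension of the subspace Σ_{e∈E} A_e(r) of the space of functions V→⋀²W is at most D·|V| − D − |R|. -/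
/- STATEMENT 2: for every rod-configuration, the span of the flats `A_e(r)` has dimension
at most `D|V| - D - |R|`. -/

set_option synthInstance.maxHeartbeats 1000000
set_option maxHeartbeats 1000000

open ExteriorAlgebra

theorem aux_euler (d k : ℕ) (x : ExtAlg d) (hx : x ∈ extGrade d k) :
    ∑ i : Fin (d + 1), ι ℝ (Pi.single i (1:ℝ) : Wd d) *
      CliffordAlgebra.contractLeft (Q := (0 : QuadraticForm ℝ (Wd d)))
        (LinearMap.proj i : Wd d →ₗ[ℝ] ℝ) x = (k : ℝ) • x := by
  unfold extGrade at hx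
  induction hx using Submodule.pow_induction_on_left' with
  | algebraMap r =>
    simp [CliffordAlgebra.contractLeft_algebraMap]
  | add x y i hx hy h1 h2 =>
    simp only [map_add, mul_add, Finset.sum_add_distrib, h1, h2, smul_add]
  | mem_mul m hm i x hx ih =>
    obtain ⟨w, rfl⟩ := hm
    have h1 : ∀ j : Fin (d + 1), ι ℝ (Pi.single j (1:ℝ) : Wd d) *
      CliffordAlgebra.contractLeft (Q := (0 : QuadraticForm ℝ (Wd d)))
        (LinearMap.proj j : Wd d →ₗ[ℝ] ℝ) (ι ℝ w * x) =
        ι ℝ (Pi.single j (w j) : Wd d) * x + ι ℝ w * (ι ℝ (Pi.single j (1:ℝ) : Wd d) *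
      CliffordAlgebra.contractLeft (Q := (0 : QuadraticForm ℝ (Wd d)))
        (LinearMap.proj j : Wd d →ₗ[ℝ] ℝ) x) := by
      intro j
      have e1 : (Pi.single j (w j) : Wd d) = w j • Pi.single j (1:ℝ) := by
        rw [← Pi.single_smul]; simp
      have e2 := CliffordAlgebra.contractLeft_ι_mul (Q := (0 : QuadraticForm ℝ (Wd d)))
        (LinearMap.proj j : Wd d →ₗ[ℝ] ℝ) w x
      have e3 := eq_neg_of_add_eq_zero_left
        (ExteriorAlgebra.ι_add_mul_swap (R := ℝ) (Pi.single j (1:ℝ) : Wd d) w)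
      change _ * CliffordAlgebra.contractLeft _ (CliffordAlgebra.ι _ w * x) = _
      rw [e2, mul_sub, ← mul_assoc, e1, map_smul]
      change _ - (ι ℝ (Pi.single j (1:ℝ) : Wd d) * ι ℝ w) * _ = _
      rw [e3]
      simp [mul_assoc]
    rw [Finset.sum_congr rfl (fun j _ => h1 j), Finset.sum_add_distrib, ← Finset.mul_sum, ih,
      ← Finset.sum_mul, ← map_sum]
    have : ∑ j, (Pi.single j (w j) : Wd d) = w := Finset.univ_sum_single w
    rw [this]
    push_cast
    rw [add_smul, one_smul, mul_smul_comm]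
    exact add_comm _ _

theorem aux_step (d k : ℕ) (hk : k < d + 1) (x : ExtAlg d) (hx : x ∈ extGrade d k)
    (h : ∀ w : Wd d, ι ℝ w * x = 0) : x = 0 := by
  have h1 := aux_euler d k x hx
  have h2 : ∀ i : Fin (d + 1), ι ℝ (Pi.single i (1:ℝ) : Wd d) *
      CliffordAlgebra.contractLeft (Q := (0 : QuadraticForm ℝ (Wd d)))
        (LinearMap.proj i : Wd d →ₗ[ℝ] ℝ) x = x := by
    intro i
    have e2 := CliffordAlgebra.contractLeft_ι_mul (Q := (0 : QuadraticForm ℝ (Wd d)))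
        (LinearMap.proj i : Wd d →ₗ[ℝ] ℝ) (Pi.single i (1:ℝ) : Wd d) x
    have e3 := h (Pi.single i (1:ℝ) : Wd d)
    change CliffordAlgebra.ι _ _ * x = 0 at e3
    rw [e3, map_zero] at e2
    have := (sub_eq_zero.mp e2.symm).symm
    simpa using this
  rw [Finset.sum_congr rfl (fun j _ => h2 j)] at h1
  simp only [Finset.sum_const, Finset.card_univ, Fintype.card_fin] at h1
  rw [← Nat.cast_smul_eq_nsmul ℝ, ← sub_eq_zero, ← sub_smul] at h1
  rcases smul_eq_zero.mp h1 with h | h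
  · exfalso
    have : ((d + 1 : ℕ) : ℝ) = k := sub_eq_zero.mp h
    have := Nat.cast_injective this
    omega
  · exact h

theorem aux_nondeg (d : ℕ) (hd : 1 ≤ d) (x : ExtAlg d) (hx : x ∈ extGrade d (d - 1))
    (h : ∀ a ∈ extGrade d 2, a * x = 0) : x = 0 := by
  apply aux_step d (d - 1) (by omega) x hx
  intro w
  apply aux_step d d (by omega)
  · have : extGrade d d = extGrade d 1 * extGrade d (d - 1) := by
      unfold extGrade
      rw [← pow_add]; congr 1; omega
    rw [this]
    refine Submodule.mul_mem_mul ?_ hx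
    unfold extGrade; rw [pow_one]; exact ⟨w, rfl⟩
  · intro w'
    rw [← mul_assoc]
    apply h
    unfold extGrade; rw [pow_two]
    exact Submodule.mul_mem_mul ⟨w', rfl⟩ ⟨w, rfl⟩

theorem aux_decomp (d k : ℕ) (x : ExtAlg d) (hx : IsDecomp d k x) : x ∈ extGrade d k := by
  obtain ⟨w, rfl⟩ := hx
  have := ExteriorAlgebra.ιMulti_range ℝ k (M := Wd d) ⟨w, rfl⟩
  rwa [ExteriorAlgebra.ιMulti_apply] at this

theorem aux_finrank (d k : ℕ) : Module.finrank ℝ (extGrade d k) = (d + 1).choose k := by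
  have := exteriorPower.finrank_eq (R := ℝ) (M := Wd d) k
  rw [Module.finrank_fin_fun] at this
  exact this

theorem aux_count {M V : Type} [AddCommGroup M] [Module ℝ M] [FiniteDimensional ℝ M]
    [Fintype V] [DecidableEq V] (hV : 2 ≤ Fintype.card V) (R : Finset V) (g : V → M →ₗ[ℝ] ℝ)
    (h0 : ∀ v ∈ R, g v ≠ 0) (hp : ∀ u ∈ R, ∀ v ∈ R, u ≠ v → ∀ c : ℝ, g u ≠ c • g v)
    (Φ : (V → M) →ₗ[ℝ] M × (R → ℝ))
    (h1 : ∀ f, (Φ f).1 = ∑ v, f v) (h2 : ∀ f v, (Φ f).2 v = g v (f v)) :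
    Module.finrank ℝ (LinearMap.ker Φ) + (Module.finrank ℝ M + R.card)
      = Module.finrank ℝ M * Fintype.card V := by
  have hs : LinearMap.range Φ = ⊤ := by
    by_contra hne
    obtain ⟨ψ, hψ, hle⟩ := Submodule.exists_le_ker_of_lt_top _ (lt_top_iff_ne_top.mpr hne)
    have key : ∀ f, ψ (Φ f) = 0 := fun f => hle ⟨f, rfl⟩
    have hΦB : ∀ v ∉ R, ∀ α, Φ (Pi.single v α) = (α, 0) := by
      intro v hv α
      refine Prod.ext ?_ (funext fun w => ?_)
      · rw [h1]; simp
      · have hw : w.1 ≠ v := fun h => hv (h ▸ w.2)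
        rw [h2, Pi.single_eq_of_ne hw]; simp
    have hΦR : ∀ v (hv : v ∈ R), ∀ α, Φ (Pi.single v α) = (α, 0) + (g v α) • (0, Pi.single ⟨v, hv⟩ 1) := by
      intro v hv α
      refine Prod.ext ?_ (funext fun w => ?_)
      · rw [h1]; simp
      · rw [h2]
        by_cases hw : w = ⟨v, hv⟩
        · subst hw; simp
        · rw [Pi.single_eq_of_ne (fun h => hw (Subtype.ext h))]; simp [hw]
    have cB : ∀ v ∉ R, ∀ α, ψ (α, 0) = 0 := fun v hv α => by rw [← hΦB v hv]; exact key _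
    have cR : ∀ v (hv : v ∈ R), ∀ α, ψ (α, 0) + g v α * ψ (0, Pi.single ⟨v, hv⟩ 1) = 0 := by
      intro v hv α
      have := key (Pi.single v α)
      rwa [hΦR v hv, map_add, map_smul, smul_eq_mul] at this
    have ha : ∀ v (hv : v ∈ R), ψ (0, Pi.single ⟨v, hv⟩ 1) = 0 := by
      intro v hv
      by_contra hav
      obtain ⟨u, hu⟩ : ∃ u, u ≠ v := by
        have : Nontrivial V := Fintype.one_lt_card_iff_nontrivial.mp hV
        exact exists_ne v
      by_cases huR : u ∈ R
      · apply hp v hv u huR hu.symm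
          (ψ (0, Pi.single ⟨u, huR⟩ 1) / ψ (0, Pi.single ⟨v, hv⟩ 1))
        ext α
        have e1 := cR v hv α
        have e2 := cR u huR α
        simp only [LinearMap.smul_apply, smul_eq_mul]
        field_simp
        linarith
      · apply h0 v hv
        ext α
        have e1 := cR v hv α
        rw [cB u huR α, zero_add] at e1
        simpa [hav] using e1
    have hc : ∀ α, ψ (α, 0) = 0 := by
      intro α
      have : Nonempty V := Fintype.card_pos_iff.mp (by omega)
      obtain ⟨v⟩ := this
      by_cases hv : v ∈ R
      · have := cR v hv α
        rwa [ha v hv, mul_zero, add_zero] at this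
      · exact cB v hv α
    apply hψ
    apply LinearMap.prod_ext
    · ext α; simpa using hc α
    · refine LinearMap.pi_ext' fun v => ?_
      ext
      simpa using ha v.1 v.2
  have := LinearMap.finrank_range_add_finrank_ker Φ
  rw [hs, finrank_top, Module.finrank_prod, Module.finrank_pi, Module.finrank_pi_fintype] at this
  simp at this
  rw [mul_comm]
  omega

theorem statement_2
    (d : ℕ) (hd : 3 ≤ d) (D : ℕ) (hD : D = (d + 1).choose 2)
    (V E : Type) [Fintype V] [Fintype E] [DecidableEq V] [DecidableEq E]
    (hV : 2 ≤ Fintype.card V)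
    (ends : E → V × V) (hloop : ∀ e : E, (ends e).1 ≠ (ends e).2)
    (B R : Finset V) (hdisj : Disjoint B R) (hcov : B ∪ R = Finset.univ)
    (r : V → ExtAlg d)
    (hr0 : ∀ v ∈ R, r v ≠ 0)
    (hrdec : ∀ v ∈ R, IsDecomp d (d - 1) (r v))
    (hrprop : ∀ u ∈ R, ∀ v ∈ R, u ≠ v → ∀ c : ℝ, r u ≠ c • r v) :
    (Module.finrank ℝ ↥(⨆ e : E, rodFlat d ends r R e) : ℤ)
      ≤ D * Fintype.card V - D - R.card := by
  have hgr : ∀ v ∈ R, r v ∈ extGrade d (d - 1) := fun v hv => aux_decomp _ _ _ (hrdec v hv)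
  have hfinD : Module.finrank ℝ (extGrade d 2) = D := by rw [aux_finrank, hD]
  have : FiniteDimensional ℝ (extGrade d 2) := by
    apply Module.finite_of_finrank_pos
    rw [aux_finrank]; exact Nat.choose_pos (by omega)
  obtain ⟨φ, hφ⟩ : ∃ φ : ExtAlg d →ₗ[ℝ] ℝ, ∀ x ∈ extGrade d (d + 1), φ x = 0 → x = 0 := by
    have h1 : Module.finrank ℝ (extGrade d (d + 1)) = 1 := by rw [aux_finrank, Nat.choose_self]
    have : FiniteDimensional ℝ (extGrade d (d + 1)) :=
      Module.finite_of_finrank_pos (by omega)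
    let e : extGrade d (d + 1) ≃ₗ[ℝ] ℝ := LinearEquiv.ofFinrankEq _ _ (by rw [h1]; simp)
    obtain ⟨φ, hφ⟩ := LinearMap.exists_extend e.toLinearMap
    refine ⟨φ, fun x hx h => ?_⟩
    have h2 : e ⟨x, hx⟩ = φ x := (LinearMap.congr_fun hφ ⟨x, hx⟩).symm
    rw [h] at h2
    exact congrArg Subtype.val ((LinearEquiv.map_eq_zero_iff e).mp h2)
  let g : V → extGrade d 2 →ₗ[ℝ] ℝ := fun v =>
    φ ∘ₗ LinearMap.mulRight ℝ (r v) ∘ₗ (extGrade d 2).subtype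
  have hg : ∀ v a, g v a = φ (a.1 * r v) := fun _ _ => rfl
  have hnd : ∀ x ∈ extGrade d (d - 1), (∀ a ∈ extGrade d 2, φ (a * x) = 0) → x = 0 := by
    intro x hx h
    apply aux_nondeg d (by omega) x hx
    intro a ha
    refine hφ _ ?_ (h a ha)
    have : extGrade d (d + 1) = extGrade d 2 * extGrade d (d - 1) := by
      unfold extGrade
      rw [← pow_add]; congr 1; omega
    rw [this]
    exact Submodule.mul_mem_mul ha hx
  let Φ : (V → extGrade d 2) →ₗ[ℝ] extGrade d 2 × (R → ℝ) :=
    LinearMap.prod (∑ v, LinearMap.proj v) (LinearMap.pi fun v => g v ∘ₗ LinearMap.proj v.1)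
  have hcount := aux_count hV R g
    (fun v hv h => hr0 v hv (hnd _ (hgr v hv) fun a ha => by
      have := LinearMap.congr_fun h ⟨a, ha⟩
      simpa [hg] using this))
    (fun u hu v hv huv c h => hrprop u hu v hv huv c (sub_eq_zero.mp
      (hnd _ (Submodule.sub_mem _ (hgr u hu) (Submodule.smul_mem _ c (hgr v hv))) fun a ha => by
        have := LinearMap.congr_fun h ⟨a, ha⟩
        simp only [hg, LinearMap.smul_apply] at this
        rw [mul_sub, mul_smul_comm, map_sub, map_smul, this, sub_self])))
    Φ (fun f => by simp [Φ]) (fun f v => by simp [Φ])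
  let J : (V → extGrade d 2) →ₗ[ℝ] (V → ExtAlg d) := (extGrade d 2).subtype.compLeft V
  have hle : (⨆ e : E, rodFlat d ends r R e) ≤ (LinearMap.ker Φ).map J := by
    refine iSup_le fun e => ?_
    rintro _ ⟨α, hα, rfl⟩
    obtain ⟨hα2, hαR⟩ := hα
    have hann : ∀ w ∈ ({(ends e).1, (ends e).2} : Finset V), w ∈ R → α * r w = 0 := by
      intro w hw hwR
      have := (Submodule.mem_iInf _).mp hαR w
      have := (Submodule.mem_iInf _).mp this (Finset.mem_inter.mpr ⟨hw, hwR⟩)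
      simpa using this
    have hgz : ∀ w ∈ ({(ends e).1, (ends e).2} : Finset V), w ∈ R → g w ⟨α, hα2⟩ = 0 := by
      intro w hw hwR
      rw [hg, hann w hw hwR, map_zero]
    refine ⟨Pi.single (ends e).1 ⟨α, hα2⟩ - Pi.single (ends e).2 ⟨α, hα2⟩, ?_, ?_⟩
    · change Φ _ = 0
      refine Prod.ext ?_ (funext fun w => ?_)
      · simp [Φ]
      · change g w ((Pi.single (ends e).1 _ - Pi.single (ends e).2 _ : V → extGrade d 2) w) = 0
        rw [Pi.sub_apply, map_sub]
        have hz : ∀ u ∈ ({(ends e).1, (ends e).2} : Finset V),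
            g w ((Pi.single u ⟨α, hα2⟩ : V → extGrade d 2) w) = 0 := by
          intro u hu
          by_cases h : w.1 = u
          · rw [h, Pi.single_eq_same]; exact hgz u hu (h ▸ w.2)
          · rw [Pi.single_eq_of_ne h, map_zero]
        rw [hz _ (by simp), hz _ (by simp), sub_zero]
    · have hJ : ∀ u, J (Pi.single u ⟨α, hα2⟩) = Pi.single u α := by
        intro u
        funext w
        change ((Pi.single u ⟨α, hα2⟩ : V → extGrade d 2) w).1 = _
        by_cases h : w = u
        · subst h; simp
        · rw [Pi.single_eq_of_ne h, Pi.single_eq_of_ne h]; rfl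
      rw [map_sub, hJ, hJ]; rfl
  have h1 := Submodule.finrank_mono hle
  have h2 := Submodule.finrank_map_le J (LinearMap.ker Φ)
  rw [hfinD] at hcount
  have h3 := h1.trans h2
  zify at hcount h3
  linarith
end
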